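/- arXiv:math/0403103 — 2 statements merged into one kernel-verified Lean document; each statement's English description precedes it below -/
import Mathlib

section
/- Let $1 \le r, s, t \le \infty$ with $\frac{1}{s} = \frac{1}{r} + \frac{1}{t}$. For any $\alpha \in M_n(\mathbb{C})$, the completely bounded norm of left multiplication by $\alpha$ as a map from the column space $C_r^n$ to $C_s^n$ equals $\|\alpha\|_{S_{2t}^n}$; similarly for right multiplication on row spaces: $\|\beta\|_{\mathcal{CB}(R_r^n, R_s^n)} = \|\beta\|_{S_{2t}^n}$. -/
open scoped ENNReal BigOperators ComplexOrder Kronecker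
open Matrix

noncomputable def ctmEig {m n : Type*} [Fintype m] [Fintype n] [DecidableEq n]
    (a : Matrix m n ℂ) : n → ℝ :=
  (Matrix.posSemidef_conjTranspose_mul_self a).isHermitian.eigenvalues

/-- Schatten `p`-norm of a (rectangular) complex matrix; `p = ∞` is the operator norm. -/
noncomputable def schNorm {m n : Type*} [Fintype m] [Fintype n] [DecidableEq n]
    (p : ℝ≥0∞) (a : Matrix m n ℂ) : ℝ :=
  if p = ∞ then ⨆ j, Real.sqrt (ctmEig a j)
  else (∑ j, ctmEig a j ^ (p.toReal / 2)) ^ (1 / p.toReal)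

/-- The element `∑ x_i ⊗ e_{i1}` of `M_K ⊗ S_r^n` representing a `K × K` matrix with
entries in the column space `C_r^n ⊂ S_r^n`. -/
noncomputable def colMat {K n : ℕ} (x : Fin n → Matrix (Fin K) (Fin K) ℂ) :
    Matrix (Fin K × Fin n) (Fin K × Fin n) ℂ :=
  Matrix.of fun P Q => if Q.2.val = 0 then x P.2 P.1 Q.1 else 0

/-- The element `∑ x_i ⊗ e_{1i}` of `M_K ⊗ S_r^n` representing a `K × K` matrix with
entries in the row space `R_r^n ⊂ S_r^n`. -/
noncomputable def rowMat {K n : ℕ} (x : Fin n → Matrix (Fin K) (Fin K) ℂ) :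
    Matrix (Fin K × Fin n) (Fin K × Fin n) ℂ :=
  Matrix.of fun P Q => if P.2.val = 0 then x Q.2 P.1 Q.1 else 0

/-- The norm of `M_K(C_r^n)` (resp. `M_K(R_r^n)`), realized inside `M_K(S_r^n)` via
Pisier's supremum formula
`‖z‖_{M_K(S_r^n)} = sup { ‖(a ⊗ 1) z (b ⊗ 1)‖_{S_r^{Kn}} : ‖a‖_{S_{2r}^K}, ‖b‖_{S_{2r}^K} ≤ 1 }`. -/
noncomputable def mkNorm (r : ℝ≥0∞) {K n : ℕ}
    (z : Matrix (Fin K × Fin n) (Fin K × Fin n) ℂ) : ℝ :=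
  sSup {c : ℝ | ∃ a b : Matrix (Fin K) (Fin K) ℂ,
    schNorm (2 * r) a ≤ 1 ∧ schNorm (2 * r) b ≤ 1 ∧
    c = schNorm r ((a ⊗ₖ (1 : Matrix (Fin n) (Fin n) ℂ)) * z *
          (b ⊗ₖ (1 : Matrix (Fin n) (Fin n) ℂ)))}

/-- The cb-norm of left multiplication by `α` as a map `C_r^n → C_s^n`
(amplifications computed through the concrete matrix-level norms `mkNorm`). -/
noncomputable def cbColNorm (r s : ℝ≥0∞) {n : ℕ} (α : Matrix (Fin n) (Fin n) ℂ) : ℝ :=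
  sSup {c : ℝ | ∃ (K : ℕ) (x : Fin n → Matrix (Fin K) (Fin K) ℂ),
    mkNorm r (colMat x) ≤ 1 ∧
    c = mkNorm s (colMat fun j => ∑ i, α j i • x i)}

/-- The cb-norm of right multiplication by `β` as a map `R_r^n → R_s^n`. -/
noncomputable def cbRowNorm (r s : ℝ≥0∞) {n : ℕ} (β : Matrix (Fin n) (Fin n) ℂ) : ℝ :=
  sSup {c : ℝ | ∃ (K : ℕ) (x : Fin n → Matrix (Fin K) (Fin K) ℂ),
    mkNorm r (rowMat x) ≤ 1 ∧
    c = mkNorm s (rowMat fun j => ∑ i, β i j • x i)}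

/-- The `ℓ^p` norm of a nonnegative vector. -/
noncomputable def vecNorm {ι : Type*} [Fintype ι] (p : ℝ≥0∞) (σ : ι → ℝ) : ℝ :=
  if p = ∞ then ⨆ j, σ j else (∑ j, σ j ^ p.toReal) ^ (1 / p.toReal)

lemma vecNorm_top {ι : Type*} [Fintype ι] (σ : ι → ℝ) : vecNorm ∞ σ = ⨆ j, σ j := by
  simp [vecNorm]

lemma vecNorm_of_ne_top {ι : Type*} [Fintype ι] {p : ℝ≥0∞} (hp : p ≠ ∞) (σ : ι → ℝ) :
    vecNorm p σ = (∑ j, σ j ^ p.toReal) ^ (1 / p.toReal) := by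
  simp [vecNorm, hp]

lemma vecNorm_nonneg {ι : Type*} [Fintype ι] (p : ℝ≥0∞) {σ : ι → ℝ} (hσ : ∀ i, 0 ≤ σ i) :
    0 ≤ vecNorm p σ := by
  unfold vecNorm
  split_ifs
  · exact Real.iSup_nonneg hσ
  · exact Real.rpow_nonneg (Finset.sum_nonneg fun i _ => Real.rpow_nonneg (hσ i) _) _

lemma toReal_pos_of_one_le {p : ℝ≥0∞} (h1 : 1 ≤ p) (hp : p ≠ ∞) : 0 < p.toReal :=
  ENNReal.toReal_pos (zero_lt_one.trans_le h1).ne' hp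

lemma one_le_toReal {p : ℝ≥0∞} (h1 : 1 ≤ p) (hp : p ≠ ∞) : 1 ≤ p.toReal := by
  simpa using ENNReal.toReal_mono hp h1

lemma le_iSup_fintype {ι : Type*} [Fintype ι] (σ : ι → ℝ) (i : ι) : σ i ≤ ⨆ j, σ j :=
  le_ciSup (Set.finite_range σ).bddAbove i

lemma le_vecNorm {ι : Type*} [Fintype ι] {p : ℝ≥0∞} (h1 : 1 ≤ p) {σ : ι → ℝ}
    (hσ : ∀ i, 0 ≤ σ i) (i : ι) : σ i ≤ vecNorm p σ := by
  by_cases hp : p = ∞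
  · subst hp
    rw [vecNorm_top]
    exact le_iSup_fintype σ i
  · rw [vecNorm_of_ne_top hp]
    have h0 := toReal_pos_of_one_le h1 hp
    rw [one_div, Real.le_rpow_inv_iff_of_pos (hσ i)
      (Finset.sum_nonneg fun i _ => Real.rpow_nonneg (hσ i) _) h0]
    exact Finset.single_le_sum (f := fun i => σ i ^ p.toReal)
      (fun i _ => Real.rpow_nonneg (hσ i) _) (Finset.mem_univ i)

lemma vecNorm_top_le {ι : Type*} [Fintype ι] {p : ℝ≥0∞} (h1 : 1 ≤ p) {σ : ι → ℝ}
    (hσ : ∀ i, 0 ≤ σ i) : vecNorm ∞ σ ≤ vecNorm p σ := by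
  rw [vecNorm_top]
  exact Real.iSup_le (le_vecNorm h1 hσ) (vecNorm_nonneg p hσ)

lemma vecNorm_le_one_iff {ι : Type*} [Fintype ι] {p : ℝ≥0∞} (h1 : 1 ≤ p) (hp : p ≠ ∞)
    {σ : ι → ℝ} (hσ : ∀ i, 0 ≤ σ i) : vecNorm p σ ≤ 1 ↔ ∑ i, σ i ^ p.toReal ≤ 1 := by
  rw [vecNorm_of_ne_top hp, one_div, Real.rpow_inv_le_iff_of_pos
    (Finset.sum_nonneg fun i _ => Real.rpow_nonneg (hσ i) _) zero_le_one
    (toReal_pos_of_one_le h1 hp), Real.one_rpow]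

/-- Hölder's inequality for products of nonnegative vectors. -/
lemma vecNorm_mul_le {ι : Type*} [Fintype ι] {p q q' : ℝ≥0∞} (hp : 1 ≤ p) (hq : 1 ≤ q)
    (hq' : 1 ≤ q') (h : p⁻¹ = q⁻¹ + q'⁻¹) {σ τ : ι → ℝ} (hσ : ∀ i, 0 ≤ σ i) (hτ : ∀ i, 0 ≤ τ i) :
    vecNorm p (fun i => σ i * τ i) ≤ vecNorm q σ * vecNorm q' τ := by
  have key : ∀ {p : ℝ≥0∞}, 1 ≤ p → ∀ {σ τ : ι → ℝ}, (∀ i, 0 ≤ σ i) → (∀ i, 0 ≤ τ i) →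
      vecNorm p (fun i => σ i * τ i) ≤ vecNorm ∞ σ * vecNorm p τ := by
    intro p hp σ τ hσ hτ
    have hS : 0 ≤ ⨆ j, σ j := Real.iSup_nonneg hσ
    by_cases h : p = ∞
    · subst h
      simp only [vecNorm_top]
      refine Real.iSup_le (fun i => ?_) (mul_nonneg hS (Real.iSup_nonneg hτ))
      exact mul_le_mul (le_iSup_fintype σ i) (le_iSup_fintype τ i) (hτ i) hS
    · have h0 := toReal_pos_of_one_le hp h
      rw [vecNorm_of_ne_top h, vecNorm_of_ne_top h, vecNorm_top]
      have : ∑ j, (σ j * τ j) ^ p.toReal ≤ (⨆ j, σ j) ^ p.toReal * ∑ j, τ j ^ p.toReal := by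
        rw [Finset.mul_sum]
        refine Finset.sum_le_sum fun i _ => ?_
        rw [Real.mul_rpow (hσ i) (hτ i)]
        exact mul_le_mul_of_nonneg_right
          (Real.rpow_le_rpow (hσ i) (le_iSup_fintype σ i) h0.le) (Real.rpow_nonneg (hτ i) _)
      refine (Real.rpow_le_rpow (Finset.sum_nonneg fun i _ =>
        Real.rpow_nonneg (mul_nonneg (hσ i) (hτ i)) _) this (by positivity)).trans_eq ?_
      rw [Real.mul_rpow (Real.rpow_nonneg hS _)
        (Finset.sum_nonneg fun i _ => Real.rpow_nonneg (hτ i) _), ← Real.rpow_mul hS,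
        mul_one_div_cancel h0.ne', Real.rpow_one]
  by_cases hqt : q = ∞
  · subst hqt
    obtain rfl : p = q' := by simpa using h
    exact key hp hσ hτ
  by_cases hqt' : q' = ∞
  · subst hqt'
    obtain rfl : p = q := by simpa using h
    rw [mul_comm (vecNorm p σ)]
    simpa only [mul_comm] using key hp hτ hσ
  have hpt : p ≠ ∞ := by
    rintro rfl
    exact hqt (by simpa using (add_eq_zero.mp (h.symm.trans ENNReal.inv_top)).1)
  have h1 := toReal_pos_of_one_le hp hpt
  have h2 := toReal_pos_of_one_le hq hqt
  have h3 := toReal_pos_of_one_le hq' hqt'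
  have hr : Real.HolderTriple q.toReal q'.toReal p.toReal := by
    refine ⟨?_, h2, h3⟩
    have := congrArg ENNReal.toReal h
    rw [ENNReal.toReal_add (by simpa using (zero_lt_one.trans_le hq).ne')
      (by simpa using (zero_lt_one.trans_le hq').ne')] at this
    simpa [ENNReal.toReal_inv] using this.symm
  have := Real.Lr_rpow_le_Lp_mul_Lq_of_nonneg Finset.univ hr (fun i _ => hσ i) (fun i _ => hτ i)
  have hs : 0 ≤ ∑ i, σ i ^ q.toReal := Finset.sum_nonneg fun i _ => Real.rpow_nonneg (hσ i) _
  have ht : 0 ≤ ∑ i, τ i ^ q'.toReal := Finset.sum_nonneg fun i _ => Real.rpow_nonneg (hτ i) _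
  rw [vecNorm_of_ne_top hpt, vecNorm_of_ne_top hqt, vecNorm_of_ne_top hqt']
  refine (Real.rpow_le_rpow (Finset.sum_nonneg fun i _ =>
        Real.rpow_nonneg (mul_nonneg (hσ i) (hτ i)) _) this (by positivity)).trans_eq ?_
  rw [Real.mul_rpow (by positivity) (by positivity), ← Real.rpow_mul hs, ← Real.rpow_mul ht]
  congr 2 <;> field_simp

lemma vecNorm_prod_le {ι κ : Type*} [Fintype ι] [Fintype κ] {p : ℝ≥0∞} {σ : ι → ℝ}
    {τ : κ → ℝ} (hσ : ∀ i, 0 ≤ σ i) (hτ : ∀ i, 0 ≤ τ i) :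
    vecNorm p (fun x : ι × κ => σ x.1 * τ x.2) ≤ vecNorm p σ * vecNorm p τ := by
  have hS : 0 ≤ ⨆ j, σ j := Real.iSup_nonneg hσ
  by_cases h : p = ∞
  · subst h
    simp only [vecNorm_top]
    refine Real.iSup_le (fun i => ?_) (mul_nonneg hS (Real.iSup_nonneg hτ))
    exact mul_le_mul (le_iSup_fintype σ i.1) (le_iSup_fintype τ i.2) (hτ i.2) hS
  · simp only [vecNorm_of_ne_top h]
    rw [← Real.mul_rpow (Finset.sum_nonneg fun i _ => Real.rpow_nonneg (hσ i) _)
      (Finset.sum_nonneg fun i _ => Real.rpow_nonneg (hτ i) _), Finset.sum_mul_sum,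
      ← Finset.sum_product', Finset.univ_product_univ]
    simp only [Real.mul_rpow (hσ _) (hτ _), le_refl]

/-- If `d` is dominated by `σ τ` when tested against nonincreasing nonnegative weights, then
Hölder's inequality holds for `d`. -/
lemma vecNorm_le_of_weak_majorization {N : ℕ} {p q q' : ℝ≥0∞} (hp : 1 ≤ p) (hq : 1 ≤ q)
    (hq' : 1 ≤ q') (h : p⁻¹ = q⁻¹ + q'⁻¹) {d σ τ : Fin N → ℝ} (hd : ∀ i, 0 ≤ d i)
    (hda : Antitone d) (hσ : ∀ i, 0 ≤ σ i) (hτ : ∀ i, 0 ≤ τ i)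
    (H : ∀ γ : Fin N → ℝ, (∀ i, 0 ≤ γ i) → Antitone γ →
      ∑ i, d i * γ i ≤ ∑ i, σ i * τ i * γ i) :
    vecNorm p d ≤ vecNorm q σ * vecNorm q' τ := by
  refine le_trans ?_ (vecNorm_mul_le hp hq hq' h hσ hτ)
  have hστ : ∀ i, 0 ≤ σ i * τ i := fun i => mul_nonneg (hσ i) (hτ i)
  by_cases hpt : p = ∞
  · subst hpt
    refine (vecNorm_top d).trans_le (Real.iSup_le (fun i => ?_) (vecNorm_nonneg _ hστ))
    have : NeZero N := ⟨fun h => by subst h; exact i.elim0⟩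
    refine (hda (Fin.zero_le i)).trans (le_trans ?_ (le_vecNorm hp hστ 0))
    · have := H (fun j => if j = 0 then 1 else 0) (fun j => by split_ifs <;> norm_num) ?_
      · simpa using this
      · intro a b hab
        dsimp only
        split_ifs with h1 h2
        · exact le_rfl
        · exact absurd (le_antisymm (h1 ▸ hab) (Fin.zero_le a)) h2
        · norm_num
        · exact le_rfl
  have h1 := one_le_toReal hp hpt
  have h0 : 0 < p.toReal := by linarith
  rw [vecNorm_of_ne_top hpt, vecNorm_of_ne_top hpt]
  refine Real.rpow_le_rpow (Finset.sum_nonneg fun i _ => Real.rpow_nonneg (hd i) _) ?_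
    (by positivity)
  have h2 := H (fun i => d i ^ (p.toReal - 1)) (fun i => Real.rpow_nonneg (hd i) _)
    (fun a b hab => Real.rpow_le_rpow (hd b) (hda hab) (by linarith))
  have h3 : ∀ i, d i * d i ^ (p.toReal - 1) = d i ^ p.toReal := fun i => by
    conv_lhs => enter [1]; rw [← Real.rpow_one (d i)]
    rw [← Real.rpow_add_of_nonneg (hd i) (by norm_num) (by linarith)]
    congr 1; ring
  have h4 : ∀ i, σ i * τ i * d i ^ (p.toReal - 1) ≤
      1 / p.toReal * (σ i * τ i) ^ p.toReal + (1 - 1 / p.toReal) * d i ^ p.toReal := fun i => by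
    have := Real.geom_mean_le_arith_mean2_weighted (w₁ := 1 / p.toReal) (w₂ := 1 - 1 / p.toReal)
      (by positivity) (by rw [sub_nonneg, div_le_one h0]; exact h1)
      (Real.rpow_nonneg (hστ i) p.toReal) (Real.rpow_nonneg (hd i) p.toReal) (by ring)
    rw [← Real.rpow_mul (hστ i), ← Real.rpow_mul (hd i), mul_one_div_cancel h0.ne',
      Real.rpow_one, show p.toReal * (1 - 1 / p.toReal) = p.toReal - 1 by field_simp] at this
    exact this
  have h5 := h2.trans (Finset.sum_le_sum fun i _ => h4 i)
  simp only [h3, Finset.sum_add_distrib, ← Finset.mul_sum] at h5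
  have h6 : 1 / p.toReal * ∑ i, d i ^ p.toReal ≤ 1 / p.toReal * ∑ i, (σ i * τ i) ^ p.toReal := by
    linarith
  exact le_of_mul_le_mul_left h6 (by positivity)

section SingularValues

open scoped Matrix.Norms.L2Operator

lemma norm_apply_le_l2_opNorm {m n : Type*} [Fintype m] [Fintype n] [DecidableEq n]
    (M : Matrix m n ℂ) (i : m) (j : n) : ‖M i j‖ ≤ ‖M‖ := by
  have h := Matrix.l2_opNorm_mulVec M (EuclideanSpace.single j 1)
  have h2 := PiLp.norm_apply_le (WithLp.toLp 2 (M *ᵥ ⇑(EuclideanSpace.single j (1 : ℂ)))) i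
  simp only [PiLp.norm_single, norm_one, mul_one] at h
  refine le_trans ?_ (h2.trans h)
  simp

lemma l2_opNorm_le_one_of_isometry {m n : Type*} [Fintype m] [Fintype n] [DecidableEq n]
    {U : Matrix m n ℂ} (h : Uᴴ * U = 1) : ‖U‖ ≤ 1 := by
  have h1 := Matrix.l2_opNorm_conjTranspose_mul_self U
  have h2 : ‖(1 : Matrix n n ℂ)‖ ≤ 1 := by
    rw [← Matrix.diagonal_one, Matrix.l2_opNorm_diagonal]
    exact (pi_norm_le_iff_of_nonneg zero_le_one).2 fun i => by simp
  rw [h] at h1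
  nlinarith [norm_nonneg U]

lemma norm_trace_diagonal_indicator_mul_le {N : ℕ} (k : Fin N) {M : Matrix (Fin N) (Fin N) ℂ}
    (hM : ‖M‖ ≤ 1) :
    ‖(diagonal (fun i => if i ≤ k then (1 : ℂ) else 0) * M).trace‖ ≤ k.val + 1 := by
  simp only [Matrix.trace, Matrix.diag, Matrix.diagonal_mul, ite_mul, one_mul, zero_mul]
  rw [← Finset.sum_filter]
  refine (norm_sum_le_of_le _ fun i _ => (norm_apply_le_l2_opNorm M i i).trans hM).trans ?_
  have : (Finset.univ.filter (· ≤ k)).card = k.val + 1 := by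
    have := Fin.card_Iic k
    rwa [← Finset.filter_ge_eq_Iic] at this
  simp [this]

lemma l2_opNorm_diagonal_indicator_le {N : ℕ} (k : Fin N) :
    ‖(diagonal (fun i => if i ≤ k then (1 : ℂ) else 0) : Matrix (Fin N) (Fin N) ℂ)‖ ≤ 1 := by
  rw [Matrix.l2_opNorm_diagonal]
  exact (pi_norm_le_iff_of_nonneg zero_le_one).2 fun i => by split_ifs <;> simp

lemma l2_opNorm_mul_le_one {m n k : Type*} [Fintype m] [Fintype n] [Fintype k] [DecidableEq n]
    [DecidableEq k] {A : Matrix m n ℂ} {B : Matrix n k ℂ} (hA : ‖A‖ ≤ 1) (hB : ‖B‖ ≤ 1) :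
    ‖A * B‖ ≤ 1 :=
  (Matrix.l2_opNorm_mul A B).trans (mul_le_one₀ hA (norm_nonneg _) hB)

/-- Abel summation: a nonincreasing nonnegative vector is a nonnegative combination of indicators
of initial segments. -/
lemma exists_sum_indicator {N : ℕ} {σ : Fin N → ℝ} (hσ : ∀ i, 0 ≤ σ i) (ha : Antitone σ) :
    ∃ δ : Fin N → ℝ, (∀ k, 0 ≤ δ k) ∧ ∀ i, σ i = ∑ k, δ k * if i ≤ k then 1 else 0 := by
  let f : ℕ → ℝ := fun k => if h : k < N then σ ⟨k, h⟩ else 0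
  refine ⟨fun k => f k - f (k + 1), fun k => ?_, fun i => ?_⟩
  · simp only [f, k.2, dite_true, sub_nonneg]
    split_ifs with h
    · exact ha (Fin.le_def.2 (Nat.le_succ _))
    · exact hσ _
  · have h1 : ∑ k : Fin N, (f k - f (k + 1)) * (if i ≤ k then 1 else 0) =
        ∑ k ∈ Finset.range N, (f k - f (k + 1)) * (if i.val ≤ k then 1 else 0) :=
      (Finset.sum_range (fun k => (f k - f (k + 1)) * (if i.val ≤ k then 1 else 0))).symm
    rw [h1]
    simp only [mul_ite, mul_one, mul_zero]
    rw [← Finset.sum_filter, show (Finset.range N).filter (fun k => i.val ≤ k) =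
      Finset.Ico i.val N by ext; simp [and_comm], Finset.sum_Ico_eq_sum_range]
    have h2 := Finset.sum_range_sub' (fun j => f (i.val + j)) (N - i.val)
    simp only [← add_assoc] at h2
    rw [h2, Nat.add_sub_cancel' i.2.le]
    simp [f]

/-- A von Neumann type trace inequality for three factors. -/
lemma norm_trace_mul_diagonal_le {N : ℕ} {σ τ γ : Fin N → ℝ} (hσ : ∀ i, 0 ≤ σ i)
    (hσa : Antitone σ) (hτ : ∀ i, 0 ≤ τ i) (hτa : Antitone τ) (hγ : ∀ i, 0 ≤ γ i)
    (hγa : Antitone γ) {X Y Z : Matrix (Fin N) (Fin N) ℂ} (hX : ‖X‖ ≤ 1) (hY : ‖Y‖ ≤ 1)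
    (hZ : ‖Z‖ ≤ 1) :
    ‖(diagonal (fun i => (σ i : ℂ)) * X * diagonal (fun i => (τ i : ℂ)) * Y *
      diagonal (fun i => (γ i : ℂ)) * Z).trace‖ ≤ ∑ i, σ i * τ i * γ i := by
  obtain ⟨a, ha, hσe⟩ := exists_sum_indicator hσ hσa
  obtain ⟨b, hb, hτe⟩ := exists_sum_indicator hτ hτa
  obtain ⟨c, hc, hγe⟩ := exists_sum_indicator hγ hγa
  let P : Fin N → Matrix (Fin N) (Fin N) ℂ := fun k => diagonal fun i => if i ≤ k then 1 else 0
  have hdiag : ∀ {σ a : Fin N → ℝ}, (∀ i, σ i = ∑ k, a k * if i ≤ k then 1 else 0) →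
      diagonal (fun i => (σ i : ℂ)) = ∑ k, (a k : ℂ) • P k := by
    intro σ a h
    ext i j
    rw [Matrix.sum_apply]
    by_cases hij : i = j
    · subst hij
      simp only [diagonal_apply_eq, h i, P, Matrix.smul_apply, smul_eq_mul]
      push_cast
      exact Finset.sum_congr rfl fun k _ => by split_ifs <;> simp only [Complex.ofReal_one, Complex.ofReal_zero]
    · simp [P, hij]
  have hP : ∀ k, ‖P k‖ ≤ 1 := l2_opNorm_diagonal_indicator_le
  have hbound : ∀ k l m : Fin N,
      ‖(P k * X * P l * Y * P m * Z).trace‖ ≤ ∑ i : Fin N, (if i ≤ k then 1 else 0) *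
        (if i ≤ l then 1 else 0) * (if i ≤ m then (1 : ℝ) else 0) := by
    intro k l m
    have e : ∑ i : Fin N, (if i ≤ k then 1 else 0) *
        (if i ≤ l then 1 else 0) * (if i ≤ m then (1 : ℝ) else 0) =
        ((min k (min l m)).val + 1 : ℝ) := by
      have h1 : (Finset.univ.filter (· ≤ min k (min l m))).card = (min k (min l m)).val + 1 := by
        have := Fin.card_Iic (min k (min l m))
        rwa [← Finset.filter_ge_eq_Iic] at this
      rw [← Nat.cast_add_one, ← h1, Finset.card_filter]
      push_cast
      refine Finset.sum_congr rfl fun i _ => ?_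
      simp only [le_min_iff]
      by_cases h1 : i ≤ k <;> by_cases h2 : i ≤ l <;> by_cases h3 : i ≤ m <;> simp [h1, h2, h3]
    rw [e]
    rcases min_choice k (min l m) with h | h <;> rw [h]
    · simp only [Matrix.mul_assoc]
      exact norm_trace_diagonal_indicator_mul_le k (l2_opNorm_mul_le_one hX
        (l2_opNorm_mul_le_one (hP l) (l2_opNorm_mul_le_one hY
        (l2_opNorm_mul_le_one (hP m) hZ))))
    · rcases min_choice l m with h | h <;> rw [h]
      · rw [show P k * X * P l * Y * P m * Z = (P k * X) * (P l * Y * P m * Z) by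
          simp only [Matrix.mul_assoc], Matrix.trace_mul_comm]
        simp only [Matrix.mul_assoc]
        exact norm_trace_diagonal_indicator_mul_le l (l2_opNorm_mul_le_one hY
          (l2_opNorm_mul_le_one (hP m) (l2_opNorm_mul_le_one hZ
          (l2_opNorm_mul_le_one (hP k) hX))))
      · rw [show P k * X * P l * Y * P m * Z = (P k * X * P l * Y) * (P m * Z) by
          simp only [Matrix.mul_assoc], Matrix.trace_mul_comm]
        simp only [Matrix.mul_assoc]
        exact norm_trace_diagonal_indicator_mul_le m (l2_opNorm_mul_le_one hZ
          (l2_opNorm_mul_le_one (hP k) (l2_opNorm_mul_le_one hX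
          (l2_opNorm_mul_le_one (hP l) hY))))
  have hexp : (diagonal (fun i => (σ i : ℂ)) * X * diagonal (fun i => (τ i : ℂ)) * Y *
      diagonal (fun i => (γ i : ℂ)) * Z).trace = ∑ k, ∑ l, ∑ m,
      ((a k * b l * c m : ℝ) : ℂ) * (P k * X * P l * Y * P m * Z).trace := by
    rw [hdiag hσe, hdiag hτe, hdiag hγe]
    simp only [Finset.sum_mul, Finset.mul_sum, Matrix.trace_sum, Matrix.smul_mul, Matrix.mul_smul,
      Matrix.trace_smul, smul_eq_mul]
    rw [Finset.sum_comm]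
    conv_lhs => enter [2, l]; rw [Finset.sum_comm]
    rw [Finset.sum_comm]
    refine Finset.sum_congr rfl fun k _ => ?_
    refine Finset.sum_congr rfl fun l _ => Finset.sum_congr rfl fun m _ => ?_
    push_cast
    ring
  rw [hexp]
  calc _ ≤ ∑ k, ∑ l, ∑ m, a k * b l * c m * ∑ i : Fin N, (if i ≤ k then 1 else 0) *
        (if i ≤ l then 1 else 0) * (if i ≤ m then (1 : ℝ) else 0) := by
        refine norm_sum_le_of_le _ fun k _ => norm_sum_le_of_le _ fun l _ =>
          norm_sum_le_of_le _ fun m _ => ?_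
        have h0 : 0 ≤ a k * b l * c m := mul_nonneg (mul_nonneg (ha k) (hb l)) (hc m)
        rw [norm_mul, Complex.norm_real, Real.norm_of_nonneg h0]
        exact mul_le_mul_of_nonneg_left (hbound k l m) h0
    _ = ∑ i, σ i * τ i * γ i := by
        simp only [Finset.mul_sum]
        conv_lhs => enter [2, k, 2, l]; rw [Finset.sum_comm]
        conv_lhs => enter [2, k]; rw [Finset.sum_comm]
        rw [Finset.sum_comm]
        refine Finset.sum_congr rfl fun i _ => ?_
        rw [hσe i, hτe i, hγe i]
        simp only [Finset.sum_mul, Finset.mul_sum]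
        conv_rhs => rw [Finset.sum_comm]
        conv_rhs => enter [2, k]; rw [Finset.sum_comm]
        conv_rhs => rw [Finset.sum_comm]
        refine Finset.sum_congr rfl fun k _ => ?_
        refine Finset.sum_congr rfl fun l _ => Finset.sum_congr rfl fun m _ => ?_
        ring

end SingularValues

lemma map_ctmEig_eq {m n κ : Type*} [Fintype m] [Fintype n] [DecidableEq n] [Fintype κ]
    [DecidableEq κ] {A : Matrix m n ℂ} {d : κ → ℝ}
    (h : (Aᴴ * A).charpoly = (diagonal fun k => ((d k : ℂ)) ^ 2).charpoly) :
    Finset.univ.val.map (ctmEig A) = Finset.univ.val.map fun k => d k ^ 2 := by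
  have h1 := (Matrix.posSemidef_conjTranspose_mul_self A).isHermitian.roots_charpoly_eq_eigenvalues
  rw [h, Matrix.charpoly_diagonal, Polynomial.roots_prod _ _
    (Finset.prod_ne_zero_iff.2 fun k _ => Polynomial.X_sub_C_ne_zero _)] at h1
  have h2 := congrArg (Multiset.map RCLike.re) h1
  simp only [Polynomial.roots_X_sub_C, Multiset.bind_singleton, Multiset.map_map] at h2
  simpa [ctmEig, Function.comp_def, ← Complex.ofReal_pow] using h2.symm

lemma schNorm_eq_vecNorm {m n κ : Type*} [Fintype m] [Fintype n] [DecidableEq n] [Fintype κ]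
    [DecidableEq κ] {A : Matrix m n ℂ} {d : κ → ℝ} (hd : ∀ k, 0 ≤ d k)
    (h : (Aᴴ * A).charpoly = (diagonal fun k => ((d k : ℂ)) ^ 2).charpoly) (p : ℝ≥0∞) :
    schNorm p A = vecNorm p d := by
  have hm := map_ctmEig_eq h
  unfold schNorm vecNorm
  split_ifs with hp
  · have h1 := congrArg (fun s => {x | x ∈ Multiset.map Real.sqrt s}) hm
    simp only [Multiset.map_map, Function.comp_def, Real.sqrt_sq (hd _), Multiset.mem_map,
      Finset.mem_val, Finset.mem_univ, true_and] at h1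
    exact congrArg sSup h1
  · have h1 := congrArg (fun s => (Multiset.map (fun x : ℝ => x ^ (p.toReal / 2)) s).sum) hm
    simp only [Multiset.map_map, Function.comp_def] at h1
    congr 1
    refine Eq.trans h1 (Finset.sum_congr rfl fun k _ => ?_)
    rw [← Real.rpow_natCast, ← Real.rpow_mul (hd k)]
    congr 1
    push_cast
    ring

lemma schNorm_eq_of_charpoly_eq {m n m' n' : Type*} [Fintype m] [Fintype n] [DecidableEq n]
    [Fintype m'] [Fintype n'] [DecidableEq n'] {A : Matrix m n ℂ} {B : Matrix m' n' ℂ}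
    (h : (Aᴴ * A).charpoly = (Bᴴ * B).charpoly) (p : ℝ≥0∞) : schNorm p A = schNorm p B := by
  have hB : ∀ k, 0 ≤ ctmEig B k :=
    (Matrix.posSemidef_conjTranspose_mul_self B).eigenvalues_nonneg
  have hd : (Bᴴ * B).charpoly = (diagonal fun k => (√(ctmEig B k) : ℂ) ^ 2).charpoly := by
    rw [(Matrix.posSemidef_conjTranspose_mul_self B).isHermitian.charpoly_eq,
      Matrix.charpoly_diagonal]
    refine Finset.prod_congr rfl fun k _ => ?_
    rw [← Complex.ofReal_pow, Real.sq_sqrt (hB k)]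
    rfl
  have hnn : ∀ k, 0 ≤ √(ctmEig B k) := fun k => Real.sqrt_nonneg _
  rw [schNorm_eq_vecNorm hnn (h.trans hd), schNorm_eq_vecNorm hnn hd]

lemma schNorm_nonneg {m n : Type*} [Fintype m] [Fintype n] [DecidableEq n] (p : ℝ≥0∞)
    (A : Matrix m n ℂ) : 0 ≤ schNorm p A := by
  have h : ∀ k, 0 ≤ ctmEig A k :=
    (Matrix.posSemidef_conjTranspose_mul_self A).eigenvalues_nonneg
  unfold schNorm
  split_ifs
  · exact Real.iSup_nonneg fun j => Real.sqrt_nonneg _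
  · exact Real.rpow_nonneg (Finset.sum_nonneg fun i _ => Real.rpow_nonneg (h i) _) _

lemma charpoly_conj_eq {ι κ : Type*} [Fintype ι] [DecidableEq ι] [Fintype κ] [DecidableEq κ]
    (e : ι ≃ κ) {V : Matrix ι κ ℂ} (h : Vᴴ * V = 1) (M : Matrix κ κ ℂ) :
    (V * M * Vᴴ).charpoly = M.charpoly := by
  have h1 : ((V * M).submatrix id e * (Vᴴ).submatrix e id) = V * M * Vᴴ := by
    rw [Matrix.submatrix_mul_equiv]; rfl
  rw [← h1, Matrix.charpoly_mul_comm, ← Matrix.submatrix_mul _ _ _ id _ Function.bijective_id,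
    ← Matrix.mul_assoc, h, Matrix.one_mul]
  exact Matrix.charpoly_reindex e.symm M

/-- A singular value decomposition `A = U diag(σ) Vᴴ`. -/
structure IsSVD {ι κ : Type*} [Fintype ι] [Fintype κ] [DecidableEq κ] (A : Matrix ι ι ℂ)
    (U : Matrix ι κ ℂ) (σ : κ → ℝ) (V : Matrix ι κ ℂ) : Prop where
  eq : A = U * diagonal (fun k => (σ k : ℂ)) * Vᴴ
  left : Uᴴ * U = 1
  right : Vᴴ * V = 1
  nonneg : ∀ k, 0 ≤ σ k

lemma conjTranspose_diagonal_ofReal {κ : Type*} [DecidableEq κ] (σ : κ → ℝ) :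
    (diagonal fun k => (σ k : ℂ))ᴴ = diagonal fun k => (σ k : ℂ) := by
  rw [Matrix.diagonal_conjTranspose]
  congr 1
  ext k
  simp

lemma gram_mul_diagonal {ι κ : Type*} [Fintype ι] [Fintype κ] [DecidableEq κ]
    {U V : Matrix ι κ ℂ} (hU : Uᴴ * U = 1) (σ : κ → ℝ) :
    (U * diagonal (fun k => (σ k : ℂ)) * Vᴴ)ᴴ * (U * diagonal (fun k => (σ k : ℂ)) * Vᴴ) =
      V * diagonal (fun k => (σ k : ℂ) ^ 2) * Vᴴ := by
  rw [Matrix.conjTranspose_mul, Matrix.conjTranspose_mul, Matrix.conjTranspose_conjTranspose,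
    conjTranspose_diagonal_ofReal]
  calc _ = V * (diagonal (fun k => (σ k : ℂ)) * (Uᴴ * U) * diagonal (fun k => (σ k : ℂ))) * Vᴴ := by
        simp only [Matrix.mul_assoc]
    _ = _ := by
        rw [hU, Matrix.mul_one, Matrix.diagonal_mul_diagonal]
        simp only [sq]

lemma IsSVD.schNorm_eq {ι κ : Type*} [Fintype ι] [DecidableEq ι] [Fintype κ] [DecidableEq κ]
    {A : Matrix ι ι ℂ} {U V : Matrix ι κ ℂ} {σ : κ → ℝ} (h : IsSVD A U σ V) (e : ι ≃ κ)
    (p : ℝ≥0∞) : schNorm p A = vecNorm p σ := by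
  refine schNorm_eq_vecNorm h.nonneg ?_ p
  rw [h.eq, gram_mul_diagonal h.left, charpoly_conj_eq e h.right]

lemma exists_unitary_diag {ι : Type*} [Fintype ι] [DecidableEq ι] {B : Matrix ι ι ℂ} {d : ι → ℝ}
    (hd : ∀ i, 0 ≤ d i) (hB : Bᴴ * B = diagonal fun k => (d k : ℂ)) :
    ∃ U : Matrix ι ι ℂ, Uᴴ * U = 1 ∧ B = U * diagonal fun k => (√(d k) : ℂ) := by
  have hinner : ∀ j k, inner ℂ (WithLp.toLp 2 (fun i => B i j) : EuclideanSpace ℂ ι)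
      (WithLp.toLp 2 (fun i => B i k)) = if j = k then (d k : ℂ) else 0 := by
    intro j k
    have := congrFun (congrFun hB j) k
    simp only [Matrix.mul_apply, Matrix.conjTranspose_apply, Matrix.diagonal_apply] at this
    rw [PiLp.inner_apply]
    simp only [RCLike.inner_apply]
    rw [show (if j = k then (d k : ℂ) else 0) = if j = k then (d j : ℂ) else 0 by
      split_ifs with h <;> simp [h], ← this]
    exact Finset.sum_congr rfl fun i _ => by rw [mul_comm]; rfl
  let v : ι → EuclideanSpace ℂ ι := fun j => ((√(d j))⁻¹ : ℂ) • WithLp.toLp 2 (fun i => B i j)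
  have hv : Orthonormal ℂ (({j | d j ≠ 0} : Set ι).domRestrict v) := by
    rw [orthonormal_iff_ite]
    rintro ⟨j, hj⟩ ⟨k, hk⟩
    simp only [Set.domRestrict_apply, v, inner_smul_left, inner_smul_right, hinner, Subtype.mk.injEq]
    split_ifs with h
    · subst h
      have h0 : √(d j) ≠ 0 := by
        rw [Ne, Real.sqrt_eq_zero (hd j)]
        exact hj
      have h1 : (d j : ℂ) = (√(d j) : ℂ) * √(d j) := by
        rw [← Complex.ofReal_mul, Real.mul_self_sqrt (hd j)]
      rw [h1, ← Complex.ofReal_inv, Complex.conj_ofReal, Complex.ofReal_inv]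
      field_simp
    · simp
  obtain ⟨b, hb⟩ := hv.exists_orthonormalBasis_extension_of_card_eq (by simp)
  have hU := (EuclideanSpace.basisFun ι ℂ).toMatrix_orthonormalBasis_mem_unitary b
  refine ⟨_, Matrix.mem_unitaryGroup_iff'.1 hU, ?_⟩
  ext i j
  rw [Matrix.mul_diagonal]
  have e1 : (EuclideanSpace.basisFun ι ℂ).toBasis.toMatrix b i j = b j i := by
    simp [Module.Basis.toMatrix_apply]
  rw [e1]
  by_cases hj : d j = 0
  · have := hinner j j
    rw [if_pos rfl, hj, Complex.ofReal_zero, inner_self_eq_zero] at this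
    have h2 := congrArg (fun x : EuclideanSpace ℂ ι => x i) this
    simpa [hj] using h2
  · rw [hb j hj]
    have h0 : (√(d j) : ℂ) ≠ 0 := by
      rw [Ne, Complex.ofReal_eq_zero, Real.sqrt_eq_zero (hd j)]
      exact hj
    simp only [v, PiLp.smul_apply, smul_eq_mul]
    field_simp

/-- Existence of a singular value decomposition with nonincreasing singular values. -/
lemma exists_isSVD_antitone {ι : Type*} [Fintype ι] [DecidableEq ι] (A : Matrix ι ι ℂ) :
    ∃ U σ V, IsSVD (κ := Fin (Fintype.card ι)) A U σ V ∧ Antitone σ := by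
  let hH := (Matrix.posSemidef_conjTranspose_mul_self A).isHermitian
  let W : Matrix ι ι ℂ := hH.eigenvectorUnitary
  have hW : Wᴴ * W = 1 := Matrix.mem_unitaryGroup_iff'.1 hH.eigenvectorUnitary.2
  have hW' : W * Wᴴ = 1 := Matrix.mem_unitaryGroup_iff.1 hH.eigenvectorUnitary.2
  have hsp : Aᴴ * A = W * diagonal (fun i => (hH.eigenvalues i : ℂ)) * Wᴴ := hH.spectral_theorem
  have hnn : ∀ i, 0 ≤ hH.eigenvalues i :=
    (Matrix.posSemidef_conjTranspose_mul_self A).eigenvalues_nonneg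
  obtain ⟨U, hU, hUe⟩ := exists_unitary_diag (B := A * W) hnn (by
    rw [Matrix.conjTranspose_mul, Matrix.mul_assoc, ← Matrix.mul_assoc Aᴴ]
    refine (congrArg (fun M => Wᴴ * (M * W)) hsp).trans ?_
    calc _ = (Wᴴ * W) * diagonal (fun i => (hH.eigenvalues i : ℂ)) * (Wᴴ * W) := by
          simp only [Matrix.mul_assoc]
      _ = _ := by rw [hW, Matrix.one_mul, Matrix.mul_one])
  have hA : A = U * diagonal (fun i => (√(hH.eigenvalues i) : ℂ)) * Wᴴ := by
    rw [← hUe, Matrix.mul_assoc, hW', Matrix.mul_one]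
  let e : Fin (Fintype.card ι) ≃ ι := Fintype.equivOfCardEq (Fintype.card_fin _)
  have hsub : ∀ {U : Matrix ι ι ℂ}, Uᴴ * U = 1 → (U.submatrix id e)ᴴ * U.submatrix id e = 1 := by
    intro U hU
    rw [Matrix.conjTranspose_submatrix, ← Matrix.submatrix_mul _ _ _ id _ Function.bijective_id,
      hU, Matrix.submatrix_one_equiv]
  refine ⟨U.submatrix id e, fun k => √(hH.eigenvalues₀ k), W.submatrix id e,
    ⟨?_, hsub hU, hsub hW, fun k => Real.sqrt_nonneg _⟩,
    fun a b hab => Real.sqrt_le_sqrt (hH.eigenvalues₀_antitone hab)⟩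
  have hdiag : (diagonal fun k => (√(hH.eigenvalues₀ k) : ℂ)) =
      (diagonal (fun i => (√(hH.eigenvalues i) : ℂ))).submatrix e e := by
    rw [Matrix.submatrix_diagonal_equiv]
    congr 1
    ext k
    simp [Matrix.IsHermitian.eigenvalues, e]
  conv_lhs => rw [hA]
  rw [hdiag, Matrix.conjTranspose_submatrix, Matrix.submatrix_mul_equiv,
    Matrix.submatrix_mul_equiv, Matrix.submatrix_id_id]

/-- Existence of a singular value decomposition indexed by the rows of the matrix. -/
lemma exists_isSVD {ι : Type*} [Fintype ι] [DecidableEq ι] (A : Matrix ι ι ℂ) :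
    ∃ U σ V, IsSVD (κ := ι) A U σ V := by
  obtain ⟨U, σ, V, h, -⟩ := exists_isSVD_antitone A
  let e : ι ≃ Fin (Fintype.card ι) := Fintype.equivFin ι
  have hsub : ∀ {U : Matrix ι (Fin (Fintype.card ι)) ℂ}, Uᴴ * U = 1 →
      (U.submatrix id e)ᴴ * U.submatrix id e = 1 := by
    intro U hU
    rw [Matrix.conjTranspose_submatrix, ← Matrix.submatrix_mul _ _ _ id _ Function.bijective_id,
      hU, Matrix.submatrix_one_equiv]
  refine ⟨U.submatrix id e, fun k => σ (e k), V.submatrix id e, ⟨?_, hsub h.left, hsub h.right,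
    fun k => h.nonneg _⟩⟩
  have hdiag : (diagonal fun k => (σ (e k) : ℂ)) =
      (diagonal (fun i => (σ i : ℂ))).submatrix e e := by
    rw [Matrix.submatrix_diagonal_equiv]
    rfl
  conv_lhs => rw [h.eq]
  rw [hdiag, Matrix.conjTranspose_submatrix, Matrix.submatrix_mul_equiv,
    Matrix.submatrix_mul_equiv, Matrix.submatrix_id_id]

open scoped Matrix.Norms.L2Operator in
/-- Hölder's inequality for Schatten norms. -/
lemma schNorm_mul_le {ι : Type*} [Fintype ι] [DecidableEq ι] {p q q' : ℝ≥0∞} (hp : 1 ≤ p)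
    (hq : 1 ≤ q) (hq' : 1 ≤ q') (h : p⁻¹ = q⁻¹ + q'⁻¹) (A B : Matrix ι ι ℂ) :
    schNorm p (A * B) ≤ schNorm q A * schNorm q' B := by
  obtain ⟨U₁, σ, V₁, hA, hσ⟩ := exists_isSVD_antitone A
  obtain ⟨U₂, τ, V₂, hB, hτ⟩ := exists_isSVD_antitone B
  obtain ⟨U₃, d, V₃, hAB, hd⟩ := exists_isSVD_antitone (A * B)
  let e := Fintype.equivFin ι
  rw [hA.schNorm_eq e, hB.schNorm_eq e, hAB.schNorm_eq e]
  refine vecNorm_le_of_weak_majorization hp hq hq' h hAB.nonneg hd hA.nonneg hB.nonneg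
    fun γ hγ hγa => ?_
  have hcontr : ∀ {U V : Matrix ι (Fin (Fintype.card ι)) ℂ}, Uᴴ * U = 1 → Vᴴ * V = 1 →
      ‖Uᴴ * V‖ ≤ 1 := fun hU hV =>
    l2_opNorm_mul_le_one ((Matrix.l2_opNorm_conjTranspose _).trans_le
      (l2_opNorm_le_one_of_isometry hU)) (l2_opNorm_le_one_of_isometry hV)
  refine le_trans (le_of_eq ?_) (norm_trace_mul_diagonal_le hA.nonneg hσ hB.nonneg hτ hγ hγa
    (hcontr hA.right hB.left) (hcontr hB.right hAB.right) (hcontr hAB.left hA.left))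
  have e1 : (diagonal (fun i => (σ i : ℂ)) * (V₁ᴴ * U₂) * diagonal (fun i => (τ i : ℂ)) *
      (V₂ᴴ * V₃) * diagonal (fun i => (γ i : ℂ)) * (U₃ᴴ * U₁)).trace =
      ((∑ i, d i * γ i : ℝ) : ℂ) := by
    calc _ = (A * B * (V₃ * diagonal (fun i => (γ i : ℂ)) * U₃ᴴ)).trace := by
          rw [← Matrix.mul_assoc _ U₃ᴴ U₁, Matrix.trace_mul_comm, hA.eq, hB.eq]
          simp only [Matrix.mul_assoc]
      _ = ((U₃ᴴ * U₃) * diagonal (fun i => (d i : ℂ)) * (V₃ᴴ * V₃) *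
            diagonal (fun i => (γ i : ℂ))).trace := by
          rw [hAB.eq, ← Matrix.mul_assoc _ _ U₃ᴴ, Matrix.trace_mul_comm]
          simp only [Matrix.mul_assoc]
      _ = _ := by
          rw [hAB.left, hAB.right, Matrix.one_mul, Matrix.mul_one, Matrix.diagonal_mul_diagonal,
            Matrix.trace_diagonal]
          push_cast
          rfl
  rw [e1, Complex.norm_real, Real.norm_of_nonneg
    (Finset.sum_nonneg fun i _ => mul_nonneg (hAB.nonneg i) (hγ i))]

lemma IsSVD.kronecker {ι κ ι' κ' : Type*} [Fintype ι] [Fintype κ] [DecidableEq κ] [Fintype ι']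
    [Fintype κ'] [DecidableEq κ'] {A : Matrix ι ι ℂ} {U V : Matrix ι κ ℂ} {σ : κ → ℝ}
    {B : Matrix ι' ι' ℂ} {U' V' : Matrix ι' κ' ℂ} {τ : κ' → ℝ} (hA : IsSVD A U σ V)
    (hB : IsSVD B U' τ V') :
    IsSVD (A ⊗ₖ B) (U ⊗ₖ U') (fun x => σ x.1 * τ x.2) (V ⊗ₖ V') where
  eq := by
    conv_lhs => rw [hA.eq, hB.eq]
    rw [Matrix.mul_kronecker_mul, Matrix.mul_kronecker_mul, Matrix.diagonal_kronecker_diagonal,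
      Matrix.conjTranspose_kronecker]
    push_cast
    rfl
  left := by
    rw [Matrix.conjTranspose_kronecker, ← Matrix.mul_kronecker_mul, hA.left, hB.left,
      Matrix.one_kronecker_one]
  right := by
    rw [Matrix.conjTranspose_kronecker, ← Matrix.mul_kronecker_mul, hA.right, hB.right,
      Matrix.one_kronecker_one]
  nonneg x := mul_nonneg (hA.nonneg _) (hB.nonneg _)

lemma schNorm_kronecker_le {ι κ : Type*} [Fintype ι] [DecidableEq ι] [Fintype κ] [DecidableEq κ]
    (p : ℝ≥0∞) (A : Matrix ι ι ℂ) (B : Matrix κ κ ℂ) :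
    schNorm p (A ⊗ₖ B) ≤ schNorm p A * schNorm p B := by
  obtain ⟨U, σ, V, hA⟩ := exists_isSVD A
  obtain ⟨U', τ, V', hB⟩ := exists_isSVD B
  rw [hA.schNorm_eq (Equiv.refl _), hB.schNorm_eq (Equiv.refl _),
    (hA.kronecker hB).schNorm_eq (Equiv.refl _)]
  exact vecNorm_prod_le hA.nonneg hB.nonneg

lemma isSVD_mul_diagonal {ι : Type*} [Fintype ι] [DecidableEq ι] {U : Matrix ι ι ℂ}
    (hU : Uᴴ * U = 1) {σ : ι → ℝ} (hσ : ∀ i, 0 ≤ σ i) :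
    IsSVD (U * diagonal fun k => (σ k : ℂ)) U σ 1 :=
  ⟨by simp, hU, by simp, hσ⟩

lemma isSVD_diagonal {ι : Type*} [Fintype ι] [DecidableEq ι] {σ : ι → ℝ} (hσ : ∀ i, 0 ≤ σ i) :
    IsSVD (diagonal fun k => (σ k : ℂ)) 1 σ 1 :=
  ⟨by simp, by simp, by simp, hσ⟩

lemma isSVD_diagonal_mul {ι : Type*} [Fintype ι] [DecidableEq ι] {V : Matrix ι ι ℂ}
    (hV : Vᴴ * V = 1) {σ : ι → ℝ} (hσ : ∀ i, 0 ≤ σ i) :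
    IsSVD ((diagonal fun k => (σ k : ℂ)) * Vᴴ) 1 σ V :=
  ⟨by simp, by simp, hV, hσ⟩

lemma schNorm_transpose {ι : Type*} [Fintype ι] [DecidableEq ι] (p : ℝ≥0∞) (A : Matrix ι ι ℂ) :
    schNorm p Aᵀ = schNorm p A := by
  refine schNorm_eq_of_charpoly_eq ?_ p
  rw [show Aᵀᴴ = Aᴴᵀ from rfl, ← Matrix.transpose_mul, Matrix.charpoly_transpose,
    Matrix.charpoly_mul_comm]

lemma schNorm_top_le {ι : Type*} [Fintype ι] [DecidableEq ι] {p : ℝ≥0∞} (h1 : 1 ≤ p)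
    (A : Matrix ι ι ℂ) : schNorm ∞ A ≤ schNorm p A := by
  obtain ⟨U, σ, V, hA⟩ := exists_isSVD A
  rw [hA.schNorm_eq (Equiv.refl _), hA.schNorm_eq (Equiv.refl _)]
  exact vecNorm_top_le h1 hA.nonneg

lemma schNorm_top_one_le {ι : Type*} [Fintype ι] [DecidableEq ι] :
    schNorm ∞ (1 : Matrix ι ι ℂ) ≤ 1 := by
  have h : IsSVD (1 : Matrix ι ι ℂ) (1 : Matrix ι ι ℂ) (fun _ => 1) 1 :=
    ⟨by simp, by simp, by simp, fun _ => zero_le_one⟩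
  rw [h.schNorm_eq (Equiv.refl _), vecNorm_top]
  exact Real.iSup_le (fun _ => le_rfl) zero_le_one

lemma schNorm_top_kronecker_one_le {ι κ : Type*} [Fintype ι] [DecidableEq ι] [Fintype κ]
    [DecidableEq κ] {q : ℝ≥0∞} (hq : 1 ≤ q) {a : Matrix ι ι ℂ} (ha : schNorm q a ≤ 1) :
    schNorm ∞ (a ⊗ₖ (1 : Matrix κ κ ℂ)) ≤ 1 :=
  (schNorm_kronecker_le _ _ _).trans
    (mul_le_one₀ ((schNorm_top_le hq a).trans ha) (schNorm_nonneg _ _) schNorm_top_one_le)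

lemma toReal_inv_add {q q' : ℝ≥0∞} (hq : 1 ≤ q) (hq' : 1 ≤ q') :
    (q⁻¹ + q'⁻¹).toReal = (q⁻¹).toReal + (q'⁻¹).toReal :=
  have hne : ∀ {x : ℝ≥0∞}, 1 ≤ x → x⁻¹ ≠ ∞ := fun hx =>
    ENNReal.inv_ne_top.2 (zero_lt_one.trans_le hx).ne'
  ENNReal.toReal_add (hne hq) (hne hq')

lemma vecNorm_rpow_inv_le_one {ι : Type*} [Fintype ι] {p : ℝ≥0∞} (hp : 1 ≤ p) {g : ι → ℝ}
    (hg : ∀ i, 0 ≤ g i) (h : ∑ i, g i ≤ 1) : vecNorm p (fun i => g i ^ (p⁻¹).toReal) ≤ 1 := by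
  by_cases hpt : p = ∞
  · subst hpt
    rw [vecNorm_top]
    exact Real.iSup_le (fun _ => by simp) zero_le_one
  · have h0 := toReal_pos_of_one_le hp hpt
    rw [vecNorm_le_one_iff hp hpt fun i => Real.rpow_nonneg (hg i) _]
    simpa only [← Real.rpow_mul (hg _), ENNReal.toReal_inv, inv_mul_cancel₀ h0.ne',
      Real.rpow_one] using h

/-- A matrix in the unit ball of `S_p` factors through the unit balls of two other
Schatten classes with the corresponding exponents. -/
lemma exists_mul_eq_of_schNorm_le_one {ι : Type*} [Fintype ι] [DecidableEq ι] {p q q' : ℝ≥0∞}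
    (hp : 1 ≤ p) (hq : 1 ≤ q) (hq' : 1 ≤ q') (h : p⁻¹ = q⁻¹ + q'⁻¹) {a : Matrix ι ι ℂ}
    (ha : schNorm p a ≤ 1) :
    ∃ b c, a = b * c ∧ schNorm q b ≤ 1 ∧ schNorm q' c ≤ 1 := by
  by_cases hpt : p = ∞
  · subst hpt
    have h0 := add_eq_zero.mp (h.symm.trans ENNReal.inv_top)
    simp only [ENNReal.inv_eq_zero] at h0
    obtain ⟨rfl, rfl⟩ := h0
    exact ⟨a, 1, (Matrix.mul_one a).symm, ha, schNorm_top_one_le⟩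
  have hp0 := toReal_pos_of_one_le hp hpt
  obtain ⟨U, σ, V, hA⟩ := exists_isSVD a
  rw [hA.schNorm_eq (Equiv.refl _), vecNorm_le_one_iff hp hpt hA.nonneg] at ha
  let g : ι → ℝ := fun i => σ i ^ p.toReal
  have hg : ∀ i, 0 ≤ g i := fun i => Real.rpow_nonneg (hA.nonneg i) _
  have hg' : ∀ (r : ℝ) i, 0 ≤ g i ^ r := fun r i => Real.rpow_nonneg (hg i) _
  refine ⟨U * diagonal (fun i => ((g i ^ (q⁻¹).toReal : ℝ) : ℂ)),
    diagonal (fun i => ((g i ^ (q'⁻¹).toReal : ℝ) : ℂ)) * Vᴴ, ?_, ?_, ?_⟩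
  · have hd : diagonal (fun i => (σ i : ℂ)) = diagonal (fun i => ((g i ^ (q⁻¹).toReal : ℝ) : ℂ)) *
        diagonal (fun i => ((g i ^ (q'⁻¹).toReal : ℝ) : ℂ)) := by
      rw [Matrix.diagonal_mul_diagonal]
      congr 1
      ext i
      rw [← Complex.ofReal_mul, ← Real.rpow_add_of_nonneg (hg i) ENNReal.toReal_nonneg
        ENNReal.toReal_nonneg, ← toReal_inv_add hq hq', ← h, ← Real.rpow_mul (hA.nonneg i),
        ENNReal.toReal_inv, mul_inv_cancel₀ hp0.ne', Real.rpow_one]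
    conv_lhs => rw [hA.eq, hd]
    simp only [Matrix.mul_assoc]
  · rw [(isSVD_mul_diagonal hA.left (hg' _)).schNorm_eq (Equiv.refl _)]
    exact vecNorm_rpow_inv_le_one hq hg ha
  · rw [(isSVD_diagonal_mul hA.right (hg' _)).schNorm_eq (Equiv.refl _)]
    exact vecNorm_rpow_inv_le_one hq' hg ha

/-- Extremal vectors for the three-factor Hölder inequality. -/
lemma exists_vecNorm_le_vecNorm_mul {ι : Type*} [Fintype ι] [DecidableEq ι] {p q₁ q₂ q₃ : ℝ≥0∞}
    (hp : 1 ≤ p) (h₁ : 1 ≤ q₁) (h₂ : 1 ≤ q₂) (h₃ : 1 ≤ q₃) (h : p⁻¹ = q₁⁻¹ + q₂⁻¹ + q₃⁻¹)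
    {σ : ι → ℝ} (hσ : ∀ i, 0 ≤ σ i) :
    ∃ w β : ι → ℝ, (∀ i, 0 ≤ w i) ∧ (∀ i, 0 ≤ β i) ∧ vecNorm q₂ w ≤ 1 ∧ vecNorm q₃ β ≤ 1 ∧
      vecNorm q₁ σ ≤ vecNorm p (fun i => σ i * w i * β i) := by
  suffices H : ∃ g : ι → ℝ, (∀ i, 0 ≤ g i) ∧ ∑ i, g i ≤ 1 ∧ vecNorm q₁ σ ≤
      vecNorm p (fun i => σ i * g i ^ (q₂⁻¹).toReal * g i ^ (q₃⁻¹).toReal) by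
    obtain ⟨g, hg, hg1, hle⟩ := H
    exact ⟨_, _, fun i => Real.rpow_nonneg (hg i) _, fun i => Real.rpow_nonneg (hg i) _,
      vecNorm_rpow_inv_le_one h₂ hg hg1, vecNorm_rpow_inv_le_one h₃ hg hg1, hle⟩
  have hzero : vecNorm q₁ σ ≤ 0 → ∃ g : ι → ℝ, (∀ i, 0 ≤ g i) ∧ ∑ i, g i ≤ 1 ∧ vecNorm q₁ σ ≤
      vecNorm p (fun i => σ i * g i ^ (q₂⁻¹).toReal * g i ^ (q₃⁻¹).toReal) := fun h0 =>
    ⟨fun _ => 0, fun _ => le_rfl, by simp, h0.trans (vecNorm_nonneg _ fun i => mul_nonneg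
      (mul_nonneg (hσ i) (Real.rpow_nonneg le_rfl _)) (Real.rpow_nonneg le_rfl _))⟩
  by_cases hq : q₁ = ∞
  · subst hq
    rcases isEmpty_or_nonempty ι with hι | hι
    · exact hzero (by simp [vecNorm_top])
    obtain ⟨j, hj⟩ := exists_eq_ciSup_of_finite (f := σ)
    have hg : ∀ i, 0 ≤ (Pi.single j 1 : ι → ℝ) i := fun i => by
      by_cases hij : i = j
      · subst hij; simp
      · simp [hij]
    refine ⟨Pi.single j 1, hg, by simp, ?_⟩
    rw [vecNorm_top, ← hj]
    refine le_trans (le_of_eq ?_) (le_vecNorm hp (fun i => mul_nonneg (mul_nonneg (hσ i)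
      (Real.rpow_nonneg (hg i) _)) (Real.rpow_nonneg (hg i) _)) j)
    simp
  have hq0 := toReal_pos_of_one_le h₁ hq
  let S := ∑ i, σ i ^ q₁.toReal
  have hS0 : 0 ≤ S := Finset.sum_nonneg fun i _ => Real.rpow_nonneg (hσ i) _
  rcases hS0.eq_or_lt with hS | hS
  · refine hzero (le_of_eq ?_)
    rw [vecNorm_of_ne_top hq]
    change S ^ _ = 0
    rw [← hS, Real.zero_rpow (by positivity)]
  have hpt : p ≠ ∞ := by
    rintro rfl
    have h1 := (add_eq_zero.mp (add_eq_zero.mp (h.symm.trans ENNReal.inv_top)).1).1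
    exact hq (by simpa using h1)
  have hp0 := toReal_pos_of_one_le hp hpt
  let g : ι → ℝ := fun i => σ i ^ q₁.toReal / S
  have hg : ∀ i, 0 ≤ g i := fun i => div_nonneg (Real.rpow_nonneg (hσ i) _) hS0
  have hg1 : ∑ i, g i = 1 := by
    rw [← Finset.sum_div]
    exact div_self hS.ne'
  have hσg : ∀ i, σ i = S ^ (q₁⁻¹).toReal * g i ^ (q₁⁻¹).toReal := fun i => by
    rw [← Real.mul_rpow hS0 (hg i), mul_div_cancel₀ _ hS.ne', ← Real.rpow_mul (hσ i),
      ENNReal.toReal_inv, mul_inv_cancel₀ hq0.ne', Real.rpow_one]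
  refine ⟨g, hg, hg1.le, le_of_eq ?_⟩
  have hexp : (p⁻¹).toReal = (q₁⁻¹).toReal + (q₂⁻¹).toReal + (q₃⁻¹).toReal := by
    rw [h, ENNReal.toReal_add _ (by simpa using (zero_lt_one.trans_le h₃).ne'),
      toReal_inv_add h₁ h₂]
    exact ENNReal.add_ne_top.2 ⟨by simpa using (zero_lt_one.trans_le h₁).ne',
      by simpa using (zero_lt_one.trans_le h₂).ne'⟩
  have hterm : ∀ i, (σ i * g i ^ (q₂⁻¹).toReal * g i ^ (q₃⁻¹).toReal) ^ p.toReal =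
      (S ^ (q₁⁻¹).toReal) ^ p.toReal * g i := fun i => by
    conv_lhs => rw [hσg i]
    rw [mul_assoc, mul_assoc, ← mul_assoc (g i ^ _), ← Real.rpow_add_of_nonneg (hg i)
      ENNReal.toReal_nonneg ENNReal.toReal_nonneg, ← Real.rpow_add_of_nonneg (hg i)
      (by positivity) ENNReal.toReal_nonneg, ← hexp, Real.mul_rpow (Real.rpow_nonneg hS0 _)
      (Real.rpow_nonneg (hg i) _), ← Real.rpow_mul (hg i), ENNReal.toReal_inv p,
      inv_mul_cancel₀ hp0.ne', Real.rpow_one]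
  rw [vecNorm_of_ne_top hpt, Finset.sum_congr rfl fun i _ => hterm i, ← Finset.mul_sum, hg1,
    mul_one, ← Real.rpow_mul (Real.rpow_nonneg hS0 _), mul_one_div_cancel hp0.ne', Real.rpow_one,
    vecNorm_of_ne_top hq, ENNReal.toReal_inv, one_div]

/-- The vector `(1, 0, …, 0)`. -/
def firstCoord (n : ℕ) (i : Fin n) : ℝ := if i.val = 0 then 1 else 0

lemma firstCoord_nonneg {n : ℕ} (i : Fin n) : 0 ≤ firstCoord n i := by
  unfold firstCoord
  split_ifs <;> norm_num

lemma sum_firstCoord_succ (n : ℕ) : ∑ i, firstCoord (n + 1) i = 1 := by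
  simp [firstCoord]

/-- The matrix unit `e₁₁`. -/
noncomputable def firstProj (n : ℕ) : Matrix (Fin n) (Fin n) ℂ :=
  diagonal fun i => (firstCoord n i : ℂ)

lemma isSVD_firstProj (n : ℕ) : IsSVD (firstProj n) 1 (firstCoord n) 1 :=
  isSVD_diagonal firstCoord_nonneg

lemma schNorm_firstProj_le {p : ℝ≥0∞} (hp : 1 ≤ p) (n : ℕ) : schNorm p (firstProj n) ≤ 1 := by
  rw [(isSVD_firstProj n).schNorm_eq (Equiv.refl _)]
  by_cases hpt : p = ∞
  · subst hpt
    rw [vecNorm_top]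
    refine Real.iSup_le (fun i => ?_) zero_le_one
    unfold firstCoord
    split_ifs <;> norm_num
  · have hp0 := toReal_pos_of_one_le hp hpt
    rw [vecNorm_le_one_iff hp hpt firstCoord_nonneg]
    have hpow : ∀ i : Fin n, firstCoord n i ^ p.toReal = firstCoord n i := fun i => by
      unfold firstCoord
      split_ifs
      · exact Real.one_rpow _
      · exact Real.zero_rpow hp0.ne'
    simp only [hpow]
    rcases n with _ | n
    · simp
    · exact (sum_firstCoord_succ n).le

lemma schNorm_kronecker_firstProj_le {ι : Type*} [Fintype ι] [DecidableEq ι] {p : ℝ≥0∞}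
    (hp : 1 ≤ p) {a : Matrix ι ι ℂ} (ha : schNorm p a ≤ 1) (n : ℕ) :
    schNorm p (a ⊗ₖ firstProj n) ≤ 1 :=
  (schNorm_kronecker_le _ _ _).trans
    (mul_le_one₀ ha (schNorm_nonneg _ _) (schNorm_firstProj_le hp n))

section MatrixNorms

variable {K n : ℕ}

lemma colMat_mul_kronecker_firstProj (x : Fin n → Matrix (Fin K) (Fin K) ℂ) :
    colMat x * ((1 : Matrix (Fin K) (Fin K) ℂ) ⊗ₖ firstProj n) = colMat x := by
  rw [firstProj, ← Matrix.diagonal_one, Matrix.diagonal_kronecker_diagonal]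
  ext P Q
  rw [Matrix.mul_diagonal]
  simp only [colMat, of_apply, firstCoord]
  split_ifs <;> simp

lemma colMat_sum_smul (α : Matrix (Fin n) (Fin n) ℂ) (x : Fin n → Matrix (Fin K) (Fin K) ℂ) :
    colMat (fun j => ∑ i, α j i • x i) = ((1 : Matrix (Fin K) (Fin K) ℂ) ⊗ₖ α) * colMat x := by
  ext P Q
  simp only [colMat, of_apply, Matrix.mul_apply, Fintype.sum_prod_type, Matrix.kroneckerMap_apply,
    Matrix.one_apply]
  split_ifs
  · simp [Matrix.sum_apply]
  · simp

lemma schNorm_kronecker_mul_mul_kronecker_le {r : ℝ≥0∞} (hr : 1 ≤ r)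
    (z : Matrix (Fin K × Fin n) (Fin K × Fin n) ℂ) {a b : Matrix (Fin K) (Fin K) ℂ} {q : ℝ≥0∞}
    (hq : 1 ≤ q) (ha : schNorm q a ≤ 1) (hb : schNorm q b ≤ 1) :
    schNorm r ((a ⊗ₖ (1 : Matrix (Fin n) (Fin n) ℂ)) * z * (b ⊗ₖ 1)) ≤ schNorm r z := by
  refine (schNorm_mul_le hr hr le_top (by simp) _ _).trans ?_
  refine (mul_le_of_le_one_right (schNorm_nonneg _ _) (schNorm_top_kronecker_one_le hq hb)).trans ?_
  refine (schNorm_mul_le hr le_top hr (by simp) _ _).trans ?_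
  exact mul_le_of_le_one_left (schNorm_nonneg _ _) (schNorm_top_kronecker_one_le hq ha)

lemma one_le_two_mul {r : ℝ≥0∞} (hr : 1 ≤ r) : 1 ≤ 2 * r :=
  hr.trans (le_mul_of_one_le_left zero_le one_le_two)

lemma le_mkNorm {r : ℝ≥0∞} (hr : 1 ≤ r) (z : Matrix (Fin K × Fin n) (Fin K × Fin n) ℂ)
    {a b : Matrix (Fin K) (Fin K) ℂ} (ha : schNorm (2 * r) a ≤ 1) (hb : schNorm (2 * r) b ≤ 1) :
    schNorm r ((a ⊗ₖ (1 : Matrix (Fin n) (Fin n) ℂ)) * z * (b ⊗ₖ 1)) ≤ mkNorm r z := by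
  refine le_csSup ⟨schNorm r z, ?_⟩ ⟨a, b, ha, hb, rfl⟩
  rintro c ⟨a, b, ha, hb, rfl⟩
  exact schNorm_kronecker_mul_mul_kronecker_le hr z (one_le_two_mul hr) ha hb

lemma mkNorm_transpose (r : ℝ≥0∞) (z : Matrix (Fin K × Fin n) (Fin K × Fin n) ℂ) :
    mkNorm r zᵀ = mkNorm r z := by
  have hk : ∀ a : Matrix (Fin K) (Fin K) ℂ,
      (a ⊗ₖ (1 : Matrix (Fin n) (Fin n) ℂ))ᵀ = aᵀ ⊗ₖ 1 := fun a => by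
    conv_rhs => rw [← Matrix.transpose_one]
    exact (Matrix.kroneckerMap_transpose _ a 1).symm
  have hc : ∀ (z : Matrix (Fin K × Fin n) (Fin K × Fin n) ℂ) (a b : Matrix (Fin K) (Fin K) ℂ),
      schNorm r ((a ⊗ₖ (1 : Matrix (Fin n) (Fin n) ℂ)) * zᵀ * (b ⊗ₖ 1)) =
        schNorm r ((bᵀ ⊗ₖ (1 : Matrix (Fin n) (Fin n) ℂ)) * z * (aᵀ ⊗ₖ 1)) := fun z a b => by
    rw [← schNorm_transpose, Matrix.transpose_mul, Matrix.transpose_mul, hk, hk,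
      Matrix.transpose_transpose, Matrix.mul_assoc]
  refine congrArg sSup (Set.ext fun c => ⟨?_, ?_⟩)
  · rintro ⟨a, b, ha, hb, rfl⟩
    exact ⟨bᵀ, aᵀ, (schNorm_transpose _ _).trans_le hb, (schNorm_transpose _ _).trans_le ha,
      hc z a b⟩
  · rintro ⟨a, b, ha, hb, rfl⟩
    refine ⟨bᵀ, aᵀ, (schNorm_transpose _ _).trans_le hb, (schNorm_transpose _ _).trans_le ha, ?_⟩
    rw [hc, Matrix.transpose_transpose, Matrix.transpose_transpose]

lemma mkNorm_rowMat (r : ℝ≥0∞) (x : Fin n → Matrix (Fin K) (Fin K) ℂ) :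
    mkNorm r (rowMat x) = mkNorm r (colMat fun i => (x i)ᵀ) := by
  rw [← mkNorm_transpose]
  rfl

lemma cbRowNorm_eq (r s : ℝ≥0∞) (β : Matrix (Fin n) (Fin n) ℂ) :
    cbRowNorm r s β = cbColNorm r s βᵀ := by
  have hT : ∀ {K : ℕ} (x : Fin n → Matrix (Fin K) (Fin K) ℂ),
      mkNorm s (rowMat fun j => ∑ i, β i j • x i) =
        mkNorm s (colMat fun j => ∑ i, βᵀ j i • (x i)ᵀ) := fun x => by
    rw [mkNorm_rowMat]
    simp only [Matrix.transpose_sum, Matrix.transpose_smul, Matrix.transpose_apply]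
  refine congrArg sSup (Set.ext fun c => ⟨?_, ?_⟩)
  · rintro ⟨K, x, hx, rfl⟩
    rw [mkNorm_rowMat] at hx
    exact ⟨K, fun i => (x i)ᵀ, hx, hT x⟩
  · rintro ⟨K, x, hx, rfl⟩
    refine ⟨K, fun i => (x i)ᵀ, ?_, ?_⟩
    · rw [mkNorm_rowMat]
      simpa only [Matrix.transpose_transpose] using hx
    · rw [hT]
      simp only [Matrix.transpose_transpose]

lemma inv_two_mul_add_inv_two_mul (r : ℝ≥0∞) : (2 * r)⁻¹ + (2 * r)⁻¹ = r⁻¹ := by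
  rw [ENNReal.mul_inv (by simp) (by simp), ← add_mul, ENNReal.inv_two_add_inv_two, one_mul]

lemma inv_two_mul_eq_add {r s t : ℝ≥0∞} (h : s⁻¹ = r⁻¹ + t⁻¹) :
    (2 * s)⁻¹ = (2 * r)⁻¹ + (2 * t)⁻¹ := by
  simp only [ENNReal.mul_inv (Or.inl (two_ne_zero (α := ℝ≥0∞)))
    (Or.inl (ENNReal.ofNat_ne_top (n := 2))), h, mul_add]

/-- Upper bound for the amplifications of left multiplication by `α`. -/
lemma mkNorm_colMat_sum_smul_le {r s t : ℝ≥0∞} (hr : 1 ≤ r) (hs : 1 ≤ s) (ht : 1 ≤ t)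
    (h : s⁻¹ = r⁻¹ + t⁻¹) (α : Matrix (Fin n) (Fin n) ℂ)
    {x : Fin n → Matrix (Fin K) (Fin K) ℂ} (hx : mkNorm r (colMat x) ≤ 1) :
    mkNorm s (colMat fun j => ∑ i, α j i • x i) ≤ schNorm (2 * t) α := by
  refine Real.sSup_le ?_ (schNorm_nonneg _ _)
  rintro c ⟨a, b, ha, hb, rfl⟩
  have hr2 := one_le_two_mul hr
  have hs2 := one_le_two_mul hs
  have ht2 := one_le_two_mul ht
  have h2 := inv_two_mul_eq_add h
  obtain ⟨a₁, a₂, rfl, ha₁, ha₂⟩ := exists_mul_eq_of_schNorm_le_one hs2 ht2 hr2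
    (h2.trans (add_comm _ _)) ha
  obtain ⟨b₁, b₂, rfl, hb₁, hb₂⟩ := exists_mul_eq_of_schNorm_le_one hs2 hr2 ht2 h2 hb
  have e : ((a₁ * a₂) ⊗ₖ (1 : Matrix (Fin n) (Fin n) ℂ)) *
      colMat (fun j => ∑ i, α j i • x i) * ((b₁ * b₂) ⊗ₖ 1) =
      (a₁ ⊗ₖ α) * ((a₂ ⊗ₖ 1) * colMat x * (b₁ ⊗ₖ 1)) * (b₂ ⊗ₖ firstProj n) := by
    rw [colMat_sum_smul]
    have e1 : ((a₁ * a₂) ⊗ₖ (1 : Matrix (Fin n) (Fin n) ℂ)) * (1 ⊗ₖ α) =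
        (a₁ ⊗ₖ α) * (a₂ ⊗ₖ 1) := by
      simp only [← Matrix.mul_kronecker_mul, Matrix.one_mul, Matrix.mul_one]
    have e2 : (1 ⊗ₖ firstProj n) * ((b₁ * b₂) ⊗ₖ (1 : Matrix (Fin n) (Fin n) ℂ)) =
        (b₁ ⊗ₖ 1) * (b₂ ⊗ₖ firstProj n) := by
      simp only [← Matrix.mul_kronecker_mul, Matrix.one_mul, Matrix.mul_one]
    conv_lhs => rw [← colMat_mul_kronecker_firstProj x]
    rw [← Matrix.mul_assoc, e1, ← Matrix.mul_assoc, Matrix.mul_assoc _ (1 ⊗ₖ firstProj n), e2]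
    simp only [Matrix.mul_assoc]
  have hp : s⁻¹ = ((2 * t)⁻¹ + r⁻¹) + (2 * t)⁻¹ := by
    rw [h, ← inv_two_mul_add_inv_two_mul t]
    ring
  have hp1 : 1 ≤ ((2 * t)⁻¹ + r⁻¹)⁻¹ :=
    ENNReal.one_le_inv.2 ((self_le_add_right _ _).trans (hp.symm.trans_le (ENNReal.inv_le_one.2 hs)))
  rw [e]
  calc _ ≤ _ := schNorm_mul_le hs hp1 ht2 (by rw [inv_inv, hp]) _ _
    _ ≤ _ := mul_le_of_le_one_right (schNorm_nonneg _ _)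
        (schNorm_kronecker_firstProj_le ht2 hb₂ n)
    _ ≤ _ := schNorm_mul_le hp1 ht2 hr (inv_inv _) _ _
    _ ≤ _ := mul_le_of_le_one_right (schNorm_nonneg _ _) ((le_mkNorm hr _ ha₂ hb₁).trans hx)
    _ ≤ _ := schNorm_kronecker_le _ _ _
    _ ≤ _ := mul_le_of_le_one_left (schNorm_nonneg _ _) ha₁

/-- The matrix of `M_n(C_r^n)` all of whose entries outside the first row vanish, and whose
first row is given by `W`. -/
noncomputable def firstRowCol (W : Matrix (Fin n) (Fin n) ℂ) (j : Fin n) :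
    Matrix (Fin n) (Fin n) ℂ :=
  Matrix.of fun P Q => firstCoord n P * W j Q

lemma sum_smul_firstRowCol (α W : Matrix (Fin n) (Fin n) ℂ) (j : Fin n) :
    ∑ i, α j i • firstRowCol W i = firstRowCol (α * W) j := by
  ext P Q
  simp only [firstRowCol, Matrix.sum_apply, Matrix.smul_apply, of_apply, smul_eq_mul,
    Matrix.mul_apply, Finset.mul_sum]
  exact Finset.sum_congr rfl fun i _ => by ring

lemma firstCoord_mul_self (i : Fin n) : firstCoord n i * firstCoord n i = firstCoord n i := by
  unfold firstCoord
  split_ifs <;> simp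

lemma firstProj_kronecker_mul_colMat_firstRowCol_mul (W b : Matrix (Fin n) (Fin n) ℂ) :
    (firstProj n ⊗ₖ (1 : Matrix (Fin n) (Fin n) ℂ)) * colMat (firstRowCol W) * (b ⊗ₖ 1) =
      colMat (firstRowCol (W * b)) := by
  have h1 : (firstProj n ⊗ₖ (1 : Matrix (Fin n) (Fin n) ℂ)) * colMat (firstRowCol W) =
      colMat (firstRowCol W) := by
    rw [firstProj, ← Matrix.diagonal_one, Matrix.diagonal_kronecker_diagonal]
    ext P Q
    rw [Matrix.diagonal_mul]
    simp only [colMat, firstRowCol, of_apply]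
    split_ifs
    · rw [mul_one, ← mul_assoc, ← Complex.ofReal_mul, firstCoord_mul_self]
    · rw [mul_zero]
  rw [h1]
  ext P Q
  simp only [Matrix.mul_apply, Fintype.sum_prod_type, Matrix.kroneckerMap_apply, Matrix.one_apply,
    colMat, firstRowCol, of_apply, mul_ite, mul_one, mul_zero, Finset.sum_ite_eq',
    Finset.mem_univ, if_true]
  split_ifs
  · simp only [Finset.mul_sum, mul_assoc]
  · simp

lemma schNorm_colMat_firstRowCol (p : ℝ≥0∞) (W : Matrix (Fin n) (Fin n) ℂ) :
    schNorm p (colMat (firstRowCol W)) = schNorm p (W ⊗ₖ firstProj n) := by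
  refine schNorm_eq_of_charpoly_eq (congrArg _ ?_) p
  ext P Q
  have hsum : ∑ i, (firstCoord n i : ℂ) = 1 := by
    rcases n with _ | n
    · exact P.1.elim0
    · exact_mod_cast sum_firstCoord_succ n
  have hC : ∀ i j (R : Fin n × Fin n), colMat (firstRowCol W) (i, j) R =
      firstCoord n i * (W j R.1 * firstCoord n R.2) := fun i j R => by
    simp only [colMat, firstRowCol, of_apply, firstCoord]
    split_ifs <;> simp
  have hsq : ∀ i, (firstCoord n i : ℂ) * firstCoord n i = firstCoord n i := fun i => by
    rw [← Complex.ofReal_mul, firstCoord_mul_self]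
  have hD : ∀ j i (R : Fin n × Fin n), (W ⊗ₖ firstProj n) (j, i) R =
      if i = R.2 then W j R.1 * firstCoord n R.2 else 0 := fun j i R => by
    simp only [Matrix.kroneckerMap_apply, firstProj, Matrix.diagonal_apply]
    split_ifs with h <;> simp [h]
  have hne : P.2 ≠ Q.2 → (firstCoord n P.2 : ℂ) * firstCoord n Q.2 = 0 := fun h => by
    unfold firstCoord
    split_ifs with h1 h2
    · exact absurd (Fin.ext (h1.trans h2.symm)) h
    all_goals simp
  simp only [Matrix.mul_apply, Matrix.conjTranspose_apply, Fintype.sum_prod_type, hC, hD]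
  rw [Finset.sum_comm]
  refine Finset.sum_congr rfl fun j _ => ?_
  set x := W j P.1
  set y := W j Q.1
  calc _ = ∑ i, (firstCoord n i : ℂ) * (star (x * firstCoord n P.2) * (y * firstCoord n Q.2)) := by
        refine Finset.sum_congr rfl fun i _ => ?_
        simp only [star_mul', Complex.star_def, Complex.conj_ofReal]
        linear_combination (starRingEnd ℂ x * firstCoord n P.2 * y * firstCoord n Q.2) * hsq i
    _ = star (x * firstCoord n P.2) * (y * firstCoord n Q.2) := by
        rw [← Finset.sum_mul, hsum, one_mul]
    _ = _ := by
        rw [Finset.sum_eq_single P.2 (fun i _ hi => by simp [hi]) (by simp), if_pos rfl]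
        split_ifs with h
        · rfl
        · rw [star_mul', Complex.star_def, Complex.conj_ofReal, mul_zero]
          linear_combination (starRingEnd ℂ x * y) * hne h

lemma mkNorm_colMat_firstRowCol_le {r : ℝ≥0∞} (hr : 1 ≤ r) {W : Matrix (Fin n) (Fin n) ℂ}
    (hW : schNorm (2 * r) W ≤ 1) : mkNorm r (colMat (firstRowCol W)) ≤ 1 := by
  have hr2 := one_le_two_mul hr
  refine Real.sSup_le ?_ zero_le_one
  rintro c ⟨a, b, ha, hb, rfl⟩
  have e : (a ⊗ₖ (1 : Matrix (Fin n) (Fin n) ℂ)) * colMat (firstRowCol W) * (b ⊗ₖ 1) =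
      (a ⊗ₖ 1) * colMat (firstRowCol W) * (b ⊗ₖ firstProj n) := by
    conv_lhs => rw [← colMat_mul_kronecker_firstProj]
    simp only [Matrix.mul_assoc, ← Matrix.mul_kronecker_mul, Matrix.one_mul, Matrix.mul_one]
  rw [e]
  refine (schNorm_mul_le hr hr2 hr2 (inv_two_mul_add_inv_two_mul r).symm _ _).trans
    (mul_le_one₀ ?_ (schNorm_nonneg _ _) (schNorm_kronecker_firstProj_le hr2 hb n))
  refine (schNorm_mul_le hr2 le_top hr2 (by simp) _ _).trans
    (mul_le_one₀ (schNorm_top_kronecker_one_le hr2 ha) (schNorm_nonneg _ _) ?_)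
  rw [schNorm_colMat_firstRowCol]
  exact schNorm_kronecker_firstProj_le hr2 hW n

lemma vecNorm_le_schNorm_kronecker_firstProj {p : ℝ≥0∞} (hp : 1 ≤ p)
    {U : Matrix (Fin n) (Fin n) ℂ} (hU : Uᴴ * U = 1) {σ : Fin n → ℝ} (hσ : ∀ i, 0 ≤ σ i) :
    vecNorm p σ ≤ schNorm p ((U * diagonal fun k => (σ k : ℂ)) ⊗ₖ firstProj n) := by
  rw [((isSVD_mul_diagonal hU hσ).kronecker (isSVD_firstProj n)).schNorm_eq (Equiv.refl _)]
  have hnn : ∀ x : Fin n × Fin n, 0 ≤ σ x.1 * firstCoord n x.2 :=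
    fun x => mul_nonneg (hσ _) (firstCoord_nonneg _)
  rcases n with _ | n
  · unfold vecNorm
    split_ifs <;> simp
  have h0 : ∀ i, σ i = σ i * firstCoord (n + 1) 0 := fun i => by simp [firstCoord]
  by_cases hpt : p = ∞
  · subst hpt
    rw [vecNorm_top]
    exact Real.iSup_le (fun i => (h0 i).trans_le (le_vecNorm hp hnn (i, 0)))
      (vecNorm_nonneg _ hnn)
  · have hp0 := toReal_pos_of_one_le hp hpt
    rw [vecNorm_of_ne_top hpt, vecNorm_of_ne_top hpt]
    refine Real.rpow_le_rpow (Finset.sum_nonneg fun i _ => Real.rpow_nonneg (hσ i) _) ?_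
      (by positivity)
    rw [Fintype.sum_prod_type]
    refine Finset.sum_le_sum fun i _ => ?_
    conv_lhs => rw [h0 i]
    exact Finset.single_le_sum (f := fun j => (σ i * firstCoord (n + 1) j) ^ p.toReal)
      (fun j _ => Real.rpow_nonneg (hnn (i, j)) _) (Finset.mem_univ 0)

/-- Left multiplication by `α` from `C_r^n` to `C_s^n` has cb-norm `‖α‖_{S_{2t}}`. -/
lemma cbColNorm_eq {r s t : ℝ≥0∞} (hr : 1 ≤ r) (hs : 1 ≤ s) (ht : 1 ≤ t)
    (h : s⁻¹ = r⁻¹ + t⁻¹) (α : Matrix (Fin n) (Fin n) ℂ) :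
    cbColNorm r s α = schNorm (2 * t) α := by
  have hub : schNorm (2 * t) α ∈ upperBounds {c : ℝ | ∃ (K : ℕ)
      (x : Fin n → Matrix (Fin K) (Fin K) ℂ), mkNorm r (colMat x) ≤ 1 ∧
        c = mkNorm s (colMat fun j => ∑ i, α j i • x i)} := by
    rintro c ⟨K, x, hx, rfl⟩
    exact mkNorm_colMat_sum_smul_le hr hs ht h α hx
  refine le_antisymm (Real.sSup_le hub (schNorm_nonneg _ _)) ?_
  obtain ⟨U, σ, V, hα⟩ := exists_isSVD α
  have hs3 : s⁻¹ = (2 * t)⁻¹ + (2 * r)⁻¹ + (2 * s)⁻¹ := by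
    rw [add_comm (2 * t)⁻¹, ← inv_two_mul_eq_add h, inv_two_mul_add_inv_two_mul]
  obtain ⟨w, β, hw, hβ, hw1, hβ1, hle⟩ := exists_vecNorm_le_vecNorm_mul hs (one_le_two_mul ht)
    (one_le_two_mul hr) (one_le_two_mul hs) hs3 hα.nonneg
  rw [← (isSVD_mul_diagonal hα.right hw).schNorm_eq (Equiv.refl _)] at hw1
  rw [← (isSVD_diagonal hβ).schNorm_eq (Equiv.refl _)] at hβ1
  refine le_trans ?_ (le_csSup ⟨_, hub⟩ ⟨n, _, mkNorm_colMat_firstRowCol_le hr hw1, rfl⟩)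
  simp only [sum_smul_firstRowCol]
  refine le_trans ?_ (le_mkNorm hs _ (schNorm_firstProj_le (one_le_two_mul hs) n) hβ1)
  rw [firstProj_kronecker_mul_colMat_firstRowCol_mul, schNorm_colMat_firstRowCol,
    hα.schNorm_eq (Equiv.refl _)]
  refine hle.trans ((vecNorm_le_schNorm_kronecker_firstProj hs hα.left fun i =>
    mul_nonneg (mul_nonneg (hα.nonneg i) (hw i)) (hβ i)).trans_eq ?_)
  have e : α * (V * diagonal fun k => (w k : ℂ)) * (diagonal fun k => (β k : ℂ)) =
      U * diagonal fun k => ((σ k * w k * β k : ℝ) : ℂ) := by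
    calc _ = U * (diagonal (fun k => (σ k : ℂ)) * (Vᴴ * V) * (diagonal fun k => (w k : ℂ)) *
          (diagonal fun k => (β k : ℂ))) := by
          rw [hα.eq]
          simp only [Matrix.mul_assoc]
      _ = _ := by
          rw [hα.right, Matrix.mul_one, Matrix.diagonal_mul_diagonal,
            Matrix.diagonal_mul_diagonal]
          push_cast
          rfl
  rw [e]

end MatrixNorms

/-- For `1/s = 1/r + 1/t`, the cb-norm of left multiplication `α : C_r^n → C_s^n`
equals `‖α‖_{S_{2t}^n}`, and similarly for right multiplication on row spaces. -/
theorem stmt_9 (r s t : ℝ≥0∞) (hr : 1 ≤ r) (hs : 1 ≤ s) (ht : 1 ≤ t)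
    (hrel : 1/s = 1/r + 1/t) (n : ℕ) (α β : Matrix (Fin n) (Fin n) ℂ) :
    cbColNorm r s α = schNorm (2 * t) α ∧
    cbRowNorm r s β = schNorm (2 * t) β := by
  simp only [one_div] at hrel
  refine ⟨cbColNorm_eq hr hs ht hrel α, ?_⟩
  rw [cbRowNorm_eq, cbColNorm_eq hr hs ht hrel, schNorm_transpose]
end

section
/- Let $E$ be an operator space, $m, n$ positive integers, and suppose $x_1, \dots, x_n \in M_m \otimes E$ admit decompositions $x_k = \sum_{r=1}^{\rho} \sum_{s=1}^{\sigma} a_k(r)\, y_k(r,s)\, b_k(s)$ with $a_k(r), b_k(s) \in M_m$ and $y_k(r,s) \in M_m \otimes E$. Then for $1 \le p < \infty$, $\Big\| \sum_{k=1}^n \delta_k \otimes x_k \Big\|_{L_p(\tau_m; \ell_1^n(E))} \le \Big\| \sum_{k,r} a_k(r) a_k(r)^* \Big\|_{L_p(\tau_m)}^{1/2} \; \sup_{1\le k \le n} \big\| \big( y_k(r,s) \big)_{r,s} \big\|_{M_{m\rho, m\sigma}(E)} \; \Big\| \sum_{k,s} b_k(s)^* b_k(s) \Big\|_{L_p(\tau_m)}^{1/2}$.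 -/
open scoped ENNReal BigOperators ComplexOrder
open Matrix

/-- Multiplication of a scalar matrix against a matrix with entries in a module. -/
def mulCME {ι κ lam : Type*} [Fintype κ] {M : Type*} [AddCommMonoid M] [Module ℂ M]
    (a : Matrix ι κ ℂ) (x : Matrix κ lam M) : Matrix ι lam M :=
  Matrix.of fun i j => ∑ k, a i k • x k j

/-- Multiplication of a module-valued matrix by a scalar matrix on the right. -/
def mulMEC {ι κ lam : Type*} [Fintype κ] {M : Type*} [AddCommMonoid M] [Module ℂ M]
    (x : Matrix ι κ M) (b : Matrix κ lam ℂ) : Matrix ι lam M :=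
  Matrix.of fun i j => ∑ k, b k j • x i k

/-- An (abstract) operator space structure on a complex vector space `E`: a family of
seminorms on all rectangular matrices over `E` satisfying Ruan's axioms. -/
structure OpSpace (E : Type) [AddCommGroup E] [Module ℂ E] : Type 1 where
  N : ∀ (ι κ : Type) [Fintype ι] [DecidableEq ι] [Fintype κ] [DecidableEq κ],
        Matrix ι κ E → ℝ
  nonneg : ∀ (ι κ : Type) [Fintype ι] [DecidableEq ι] [Fintype κ] [DecidableEq κ]
      (x : Matrix ι κ E), 0 ≤ N ι κ x
  norm_zero : ∀ (ι κ : Type) [Fintype ι] [DecidableEq ι] [Fintype κ] [DecidableEq κ],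
      N ι κ 0 = 0
  triangle : ∀ (ι κ : Type) [Fintype ι] [DecidableEq ι] [Fintype κ] [DecidableEq κ]
      (x y : Matrix ι κ E), N ι κ (x + y) ≤ N ι κ x + N ι κ y
  ruan_mul : ∀ (ι ι' κ κ' : Type) [Fintype ι] [DecidableEq ι] [Fintype ι'] [DecidableEq ι']
      [Fintype κ] [DecidableEq κ] [Fintype κ'] [DecidableEq κ']
      (a : Matrix ι' ι ℂ) (x : Matrix ι κ E) (b : Matrix κ κ' ℂ),
      N ι' κ' (mulCME a (mulMEC x b)) ≤ schNorm ⊤ a * N ι κ x * schNorm ⊤ b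
  ruan_dsum : ∀ (ι ι' κ κ' : Type) [Fintype ι] [DecidableEq ι] [Fintype ι'] [DecidableEq ι']
      [Fintype κ] [DecidableEq κ] [Fintype κ'] [DecidableEq κ']
      (x : Matrix ι κ E) (y : Matrix ι' κ' E),
      N (ι ⊕ ι') (κ ⊕ κ') (Matrix.fromBlocks x 0 0 y) ≤ max (N ι κ x) (N ι' κ' y)

variable {E : Type} [AddCommGroup E] [Module ℂ E]

/-- A linear map `u : E → M_L(ℂ)` is a complete contraction (w.r.t. the operator space
structure `os` on `E` and the operator norms on scalar matrices). -/
def CompleteContr (os : OpSpace E) {L : ℕ} (u : E →ₗ[ℂ] Matrix (Fin L) (Fin L) ℂ) : Prop :=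
  ∀ (ι κ : Type) [Fintype ι] [DecidableEq ι] [Fintype κ] [DecidableEq κ]
    (z : Matrix ι κ E),
    schNorm ⊤ (Matrix.of fun (P : ι × Fin L) (Q : κ × Fin L) => u (z P.1 Q.1) P.2 Q.2)
      ≤ os.N ι κ z

/-- The matrix norms of `ℓ_1^n(E)` (operator space `ℓ_1`-direct sum), described through
its universal property: the norm of `x ∈ M_{ι,κ}(ℓ_1^n(E))` is the supremum of
`‖∑_k (u_k)_{ι,κ}(x^k)‖` over all `n`-tuples of complete contractions `u_k : E → M_L`. -/
noncomputable def l1N (os : OpSpace E) {n : ℕ} (ι κ : Type)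
    [Fintype ι] [DecidableEq ι] [Fintype κ] [DecidableEq κ]
    (x : Matrix ι κ (Fin n → E)) : ℝ :=
  sSup {t : ℝ | ∃ (L : ℕ) (u : Fin n → (E →ₗ[ℂ] Matrix (Fin L) (Fin L) ℂ)),
    (∀ k, CompleteContr os (u k)) ∧
    t = schNorm ⊤ (Matrix.of fun (P : ι × Fin L) (Q : κ × Fin L) =>
          ∑ k, u k (x P.1 Q.1 k) P.2 Q.2)}

/-- Normalized (tracial) Schatten `p`-norm: `(τ |a|^p)^{1/p}` with `τ` the normalized trace. -/
noncomputable def ntrNorm {n : Type*} [Fintype n] [DecidableEq n]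
    (p : ℝ) (a : Matrix n n ℂ) : ℝ :=
  ((∑ j, ctmEig a j ^ (p / 2)) / (Fintype.card n)) ^ (1 / p)

/-- Pisier's vector-valued noncommutative `L_p`-norm `L_p(τ_m; ℓ_1^n(E))`, defined via
factorizations `x = α y β` with `α, β ∈ L_{2p}(τ_m)` and `y ∈ M_m ⊗_min ℓ_1^n(E)`. -/
noncomputable def LpL1 (os : OpSpace E) (p : ℝ) {m n : ℕ}
    (x : Matrix (Fin m) (Fin m) (Fin n → E)) : ℝ :=
  sInf {t : ℝ | ∃ (α β : Matrix (Fin m) (Fin m) ℂ) (y : Matrix (Fin m) (Fin m) (Fin n → E)),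
    x = mulCME α (mulMEC y β) ∧
    t = ntrNorm (2*p) α * l1N os (Fin m) (Fin m) y * ntrNorm (2*p) β}

section OperatorNorm

open scoped Matrix.Norms.L2Operator

lemma eig_diagonalization {n : Type*} [Fintype n] [DecidableEq n] {A : Matrix n n ℂ}
    (hA : A.IsHermitian) :
    A = (hA.eigenvectorUnitary : Matrix n n ℂ) *
      diagonal (fun i => (hA.eigenvalues i : ℂ)) *
      star (hA.eigenvectorUnitary : Matrix n n ℂ) := by
  have h := hA.spectral_theorem
  rw [Unitary.conjStarAlgAut_apply] at h
  exact h

lemma l2_opNorm_sq_eq_norm_ctmEig {m n : Type*} [Fintype m] [Fintype n] [DecidableEq n]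
    (a : Matrix m n ℂ) : ‖a‖ * ‖a‖ = ‖ctmEig a‖ := by
  rw [← l2_opNorm_conjTranspose_mul_self,
    eig_diagonalization (Matrix.posSemidef_conjTranspose_mul_self a).isHermitian,
    ← Unitary.coe_star, CStarRing.norm_mul_coe_unitary, CStarRing.norm_coe_unitary_mul,
    l2_opNorm_diagonal]
  simp [Pi.norm_def, ctmEig]

lemma ctmEig_nonneg {m n : Type*} [Fintype m] [Fintype n] [DecidableEq n]
    (a : Matrix m n ℂ) (j : n) : 0 ≤ ctmEig a j :=
  (Matrix.posSemidef_conjTranspose_mul_self a).eigenvalues_nonneg j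

/-- The Schatten `∞`-norm is the `ℓ²` operator norm. -/
lemma schNorm_top {m n : Type*} [Fintype m] [Fintype n] [DecidableEq n]
    (a : Matrix m n ℂ) : schNorm ⊤ a = ‖a‖ := by
  have h0 : 0 ≤ schNorm ⊤ a := by
    rw [schNorm, if_pos rfl]
    exact Real.iSup_nonneg fun j => Real.sqrt_nonneg _
  have hle (j : n) : √(ctmEig a j) ≤ schNorm ⊤ a := by
    rw [schNorm, if_pos rfl]
    exact le_ciSup (f := fun j => √(ctmEig a j)) (Set.finite_range _).bddAbove j
  refine le_antisymm ?_ ?_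
  · rw [schNorm, if_pos rfl]
    refine Real.iSup_le (fun j => Real.sqrt_le_iff.2 ⟨norm_nonneg _, ?_⟩) (norm_nonneg _)
    rw [sq, l2_opNorm_sq_eq_norm_ctmEig]
    exact (le_abs_self _).trans (norm_le_pi_norm (ctmEig a) j)
  · refine abs_le_of_sq_le_sq' ?_ h0 |>.2
    rw [sq, l2_opNorm_sq_eq_norm_ctmEig]
    refine (pi_norm_le_iff_of_nonneg (by positivity)).2 fun j => ?_
    rw [Real.norm_of_nonneg (ctmEig_nonneg a j), ← Real.sqrt_le_left h0]
    exact hle j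

lemma l2_opNorm_le_of_sum_sq_le {m n : Type*} [Fintype m] [Fintype n] [DecidableEq n]
    (a : Matrix m n ℂ) {t : ℝ} (ht : 0 ≤ t)
    (h : ∀ v : n → ℂ, ∑ i, ‖(a *ᵥ v) i‖ ^ 2 ≤ t ^ 2 * ∑ j, ‖v j‖ ^ 2) : ‖a‖ ≤ t := by
  rw [l2_opNorm_def]
  refine ContinuousLinearMap.opNorm_le_bound _ ht fun v => ?_
  refine abs_le_of_sq_le_sq' ?_ (by positivity) |>.2
  rw [mul_pow, EuclideanSpace.norm_sq_eq, EuclideanSpace.norm_sq_eq]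
  exact h v

lemma sum_sq_mulVec_le {m n : Type*} [Fintype m] [Fintype n] [DecidableEq n]
    (a : Matrix m n ℂ) (v : n → ℂ) :
    ∑ i, ‖(a *ᵥ v) i‖ ^ 2 ≤ ‖a‖ ^ 2 * ∑ j, ‖v j‖ ^ 2 := by
  have h := pow_le_pow_left₀ (norm_nonneg _) (l2_opNorm_mulVec a (WithLp.toLp 2 v)) 2
  rw [mul_pow, EuclideanSpace.norm_sq_eq, EuclideanSpace.norm_sq_eq] at h
  exact h

lemma l2_opNorm_blockDiagonal_le {m n o : Type*} [Fintype m] [Fintype n] [Fintype o]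
    [DecidableEq n] [DecidableEq o] (Z : o → Matrix m n ℂ) {t : ℝ} (ht : 0 ≤ t)
    (h : ∀ k, ‖Z k‖ ≤ t) : ‖blockDiagonal Z‖ ≤ t := by
  refine l2_opNorm_le_of_sum_sq_le _ ht fun v => ?_
  have hv (i : m) (k : o) :
      (blockDiagonal Z *ᵥ v) (i, k) = (Z k *ᵥ fun j => v (j, k)) i := by
    simp [mulVec, dotProduct, blockDiagonal_apply, Fintype.sum_prod_type]
  rw [Fintype.sum_prod_type_right, Fintype.sum_prod_type_right, Finset.mul_sum]
  refine Finset.sum_le_sum fun k _ => ?_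
  simp only [hv]
  refine (sum_sq_mulVec_le _ _).trans ?_
  have := h k
  gcongr

lemma l2_opNorm_le_one_of_mul_conjTranspose_idem {m n : Type*} [Fintype m] [Fintype n]
    [DecidableEq m] [DecidableEq n] (a : Matrix m n ℂ)
    (h : (a * aᴴ) * (a * aᴴ) = a * aᴴ) : ‖a‖ ≤ 1 := by
  have h1 : ‖a * aᴴ‖ = ‖a‖ * ‖a‖ := by
    have := l2_opNorm_conjTranspose_mul_self aᴴ
    rwa [conjTranspose_conjTranspose, l2_opNorm_conjTranspose] at this
  have h2 : ‖a * aᴴ‖ * ‖a * aᴴ‖ = ‖a * aᴴ‖ := by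
    rw [← l2_opNorm_conjTranspose_mul_self, conjTranspose_mul, conjTranspose_conjTranspose, h]
  rw [h1] at h2
  by_contra! hlt
  nlinarith [mul_pos (sub_pos.2 hlt) (sub_pos.2 hlt)]

end OperatorNorm

section Factorization

open Polynomial in
lemma sum_eigenvalues_eq_of_eq {n : Type*} [Fintype n] [DecidableEq n] {B : Matrix n n ℂ}
    (hB : B.IsHermitian) (U : Matrix.unitaryGroup n ℂ) (d : n → ℝ)
    (h : B = (U : Matrix n n ℂ) * diagonal (fun i => (d i : ℂ)) * star (U : Matrix n n ℂ))
    (f : ℝ → ℝ) : ∑ j, f (hB.eigenvalues j) = ∑ j, f (d j) := by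
  have h1 : B.charpoly.roots = Multiset.map (fun i => (d i : ℂ)) Finset.univ.val := by
    rw [h, charpoly_mul_comm, ← mul_assoc, Unitary.coe_star_mul_self, one_mul,
      charpoly_diagonal, Finset.prod_eq_multiset_prod]
    have := roots_multiset_prod_X_sub_C
      (Multiset.map (fun i => (d i : ℂ)) (Finset.univ : Finset n).val)
    rwa [Multiset.map_map] at this
  rw [hB.roots_charpoly_eq_eigenvalues] at h1
  have h2 := congrArg (fun s => (Multiset.map (fun z : ℂ => f z.re) s).sum) h1
  simpa [Multiset.map_map, Function.comp_def] using h2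

lemma ntrNorm_nonneg {n : Type*} [Fintype n] [DecidableEq n] (p : ℝ) (a : Matrix n n ℂ) :
    0 ≤ ntrNorm p a :=
  Real.rpow_nonneg (div_nonneg (Finset.sum_nonneg fun j _ =>
    Real.rpow_nonneg (ctmEig_nonneg a j) _) (Nat.cast_nonneg _)) _

/-- The matrix `U D U*` with `D` the diagonal matrix of real entries `d`. -/
noncomputable def unitaryDiag {n : Type*} [Fintype n] [DecidableEq n]
    (U : Matrix.unitaryGroup n ℂ) (d : n → ℝ) : Matrix n n ℂ :=
  (U : Matrix n n ℂ) * diagonal (fun i => (d i : ℂ)) * star (U : Matrix n n ℂ)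

lemma unitaryDiag_mul {n : Type*} [Fintype n] [DecidableEq n]
    (U : Matrix.unitaryGroup n ℂ) (d e : n → ℝ) :
    unitaryDiag U d * unitaryDiag U e = unitaryDiag U (fun i => d i * e i) := by
  have h : star (U : Matrix n n ℂ) * (U : Matrix n n ℂ) = 1 := Unitary.coe_star_mul_self U
  calc unitaryDiag U d * unitaryDiag U e
      = (U : Matrix n n ℂ) * diagonal (fun i => (d i : ℂ)) *
        (star (U : Matrix n n ℂ) * (U : Matrix n n ℂ)) * diagonal (fun i => (e i : ℂ)) *
          star (U : Matrix n n ℂ) := by simp only [unitaryDiag, Matrix.mul_assoc]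
    _ = _ := by
      rw [h, Matrix.mul_one, Matrix.mul_assoc (U : Matrix n n ℂ), diagonal_mul_diagonal]
      simp [unitaryDiag]

lemma conjTranspose_unitaryDiag {n : Type*} [Fintype n] [DecidableEq n]
    (U : Matrix.unitaryGroup n ℂ) (d : n → ℝ) : (unitaryDiag U d)ᴴ = unitaryDiag U d := by
  simp only [unitaryDiag, star_eq_conjTranspose, conjTranspose_mul, conjTranspose_conjTranspose,
    diagonal_conjTranspose, Matrix.mul_assoc]
  congr 3
  ext i
  simp

lemma ntrNorm_unitaryDiag {n : Type*} [Fintype n] [DecidableEq n]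
    (U : Matrix.unitaryGroup n ℂ) {d : n → ℝ} (hd : ∀ i, 0 ≤ d i) (p : ℝ) :
    ntrNorm p (unitaryDiag U d) = ((∑ i, d i ^ p) / Fintype.card n) ^ (1 / p) := by
  have h := sum_eigenvalues_eq_of_eq
    (Matrix.posSemidef_conjTranspose_mul_self (unitaryDiag U d)).isHermitian U
    (fun i => d i * d i) (by rw [conjTranspose_unitaryDiag, unitaryDiag_mul]; rfl)
    (fun t => t ^ (p / 2))
  have h' : ∑ j, ctmEig (unitaryDiag U d) j ^ (p / 2) = ∑ i, d i ^ p := by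
    refine h.trans (Finset.sum_congr rfl fun i _ => ?_)
    rw [← sq, ← Real.rpow_natCast, ← Real.rpow_mul (hd i)]
    congr 1
    push_cast
    ring
  rw [ntrNorm, h']

lemma ntrNorm_unitaryDiag_sqrt {n : Type*} [Fintype n] [DecidableEq n]
    (U : Matrix.unitaryGroup n ℂ) {d : n → ℝ} (hd : ∀ i, 0 ≤ d i) (p : ℝ) :
    ntrNorm (2 * p) (unitaryDiag U fun i => √(d i)) =
      ntrNorm p (unitaryDiag U d) ^ (1 / 2 : ℝ) := by
  rw [ntrNorm_unitaryDiag U (fun i => Real.sqrt_nonneg _), ntrNorm_unitaryDiag U hd,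
    ← Real.rpow_mul (div_nonneg (Finset.sum_nonneg fun j _ =>
      Real.rpow_nonneg (hd j) _) (Nat.cast_nonneg _))]
  have h (i : n) : √(d i) ^ (2 * p) = d i ^ p := by
    rw [Real.sqrt_eq_rpow, ← Real.rpow_mul (hd i)]
    congr 1
    ring
  simp only [h]
  congr 1
  ring

/-- A finite family `a` factors through the square root `α` of `∑ aᵢ aᵢ*` by a family `c` for
which `∑ cᵢ cᵢ*` is a projection. -/
lemma exists_sqrt_factorization {ι n : Type*} [Fintype ι] [Fintype n] [DecidableEq n] (p : ℝ)
    (a : ι → Matrix n n ℂ) :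
    ∃ (α : Matrix n n ℂ) (c : ι → Matrix n n ℂ), αᴴ = α ∧ (∀ i, a i = α * c i) ∧
      (∑ i, c i * (c i)ᴴ) * (∑ i, c i * (c i)ᴴ) = ∑ i, c i * (c i)ᴴ ∧
      ntrNorm (2 * p) α = ntrNorm p (∑ i, a i * (a i)ᴴ) ^ (1 / 2 : ℝ) := by
  have hA : (∑ i, a i * (a i)ᴴ).PosSemidef :=
    posSemidef_sum _ fun i _ => posSemidef_self_mul_conjTranspose (a i)
  obtain ⟨U, d, hd, hAd⟩ : ∃ (U : Matrix.unitaryGroup n ℂ) (d : n → ℝ), (∀ i, 0 ≤ d i) ∧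
      ∑ i, a i * (a i)ᴴ = unitaryDiag U d :=
    ⟨hA.isHermitian.eigenvectorUnitary, hA.isHermitian.eigenvalues, hA.eigenvalues_nonneg,
      eig_diagonalization hA.isHermitian⟩
  set α := unitaryDiag U fun i => √(d i) with hα
  set γ := unitaryDiag U fun i => (√(d i))⁻¹ with hγ
  set P := unitaryDiag U fun i => √(d i) * (√(d i))⁻¹ with hP
  have hc (i : n) (hi : d i ≠ 0) : √(d i) ≠ 0 := fun h => hi ((Real.sqrt_eq_zero (hd i)).1 h)
  have hαγ : α * γ = P := unitaryDiag_mul _ _ _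
  have hsum : ∑ i, (γ * a i) * (γ * a i)ᴴ = P := by
    have : ∑ i, (γ * a i) * (γ * a i)ᴴ = γ * (∑ i, a i * (a i)ᴴ) * γ := by
      simp only [Finset.mul_sum, Finset.sum_mul, conjTranspose_mul, Matrix.mul_assoc, hγ,
        conjTranspose_unitaryDiag]
    rw [this, hAd, hγ, unitaryDiag_mul, unitaryDiag_mul, hP]
    congr 1
    ext i
    rcases eq_or_ne (d i) 0 with h | h
    · simp [h]
    · have := hc i h
      have := Real.mul_self_sqrt (hd i)
      field_simp
      nlinarith
  have hPP : P * P = P := by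
    rw [hP, unitaryDiag_mul]
    congr 1
    ext i
    rcases eq_or_ne (d i) 0 with h | h
    · simp [h]
    · simp [hc i h]
  have hPA : P * unitaryDiag U d = unitaryDiag U d := by
    rw [hP, unitaryDiag_mul]
    congr 1
    ext i
    rcases eq_or_ne (d i) 0 with h | h
    · simp [h]
    · simp [hc i h]
  have hPa (i : ι) : a i = P * a i := by
    have h0 : ∑ i, ((1 - P) * a i) * ((1 - P) * a i)ᴴ = 0 := by
      have : ∑ i, ((1 - P) * a i) * ((1 - P) * a i)ᴴ =
          (1 - P) * (∑ i, a i * (a i)ᴴ) * (1 - P)ᴴ := by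
        simp only [Finset.mul_sum, Finset.sum_mul, conjTranspose_mul, Matrix.mul_assoc]
      rw [this, hAd, Matrix.sub_mul, hPA]
      simp
    have htr := congrArg Matrix.trace h0
    rw [trace_sum, trace_zero, Finset.sum_eq_zero_iff_of_nonneg fun i _ =>
      (posSemidef_self_mul_conjTranspose _).trace_nonneg] at htr
    have := trace_mul_conjTranspose_self_eq_zero_iff.1 (htr i (Finset.mem_univ i))
    rw [Matrix.sub_mul, Matrix.one_mul] at this
    exact sub_eq_zero.1 this
  refine ⟨α, fun i => γ * a i, conjTranspose_unitaryDiag _ _, fun i => ?_, ?_, ?_⟩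
  · rw [← Matrix.mul_assoc, hαγ, ← hPa]
  · rw [hsum, hPP]
  · rw [hAd, ntrNorm_unitaryDiag_sqrt U hd]

end Factorization

section ModuleMatrices

variable {ι κ lam μ : Type*} {M : Type*} [AddCommGroup M] [Module ℂ M]

lemma mulCME_mul [Fintype κ] [Fintype lam] (a : Matrix ι κ ℂ) (b : Matrix κ lam ℂ)
    (x : Matrix lam μ M) : mulCME (a * b) x = mulCME a (mulCME b x) := by
  ext i j
  simp only [mulCME, of_apply, Matrix.mul_apply, Finset.sum_smul, Finset.smul_sum, mul_smul]
  exact Finset.sum_comm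

lemma mulMEC_mul [Fintype κ] [Fintype lam] (x : Matrix ι κ M) (a : Matrix κ lam ℂ)
    (b : Matrix lam μ ℂ) : mulMEC x (a * b) = mulMEC (mulMEC x a) b := by
  ext i j
  simp only [mulMEC, of_apply, Matrix.mul_apply, Finset.sum_smul, Finset.smul_sum]
  rw [Finset.sum_comm]
  refine Finset.sum_congr rfl fun k _ => Finset.sum_congr rfl fun l _ => ?_
  rw [mul_comm, mul_smul]

lemma mulCME_mulMEC [Fintype κ] [Fintype lam] (a : Matrix ι κ ℂ) (x : Matrix κ lam M)
    (b : Matrix lam μ ℂ) : mulCME a (mulMEC x b) = mulMEC (mulCME a x) b := by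
  ext i j
  simp only [mulMEC, mulCME, of_apply, Finset.smul_sum]
  rw [Finset.sum_comm]
  exact Finset.sum_congr rfl fun k _ => Finset.sum_congr rfl fun l _ => smul_comm _ _ _

lemma mulCME_sum [Fintype κ] {o : Type*} (s : Finset o) (a : Matrix ι κ ℂ)
    (x : o → Matrix κ lam M) : mulCME a (∑ t ∈ s, x t) = ∑ t ∈ s, mulCME a (x t) := by
  ext i j
  simp only [mulCME, of_apply, Matrix.sum_apply, Finset.smul_sum]
  exact Finset.sum_comm

lemma mulMEC_sum [Fintype κ] {o : Type*} (s : Finset o) (x : o → Matrix ι κ M)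
    (b : Matrix κ lam ℂ) : mulMEC (∑ t ∈ s, x t) b = ∑ t ∈ s, mulMEC (x t) b := by
  ext i j
  simp only [mulMEC, of_apply, Matrix.sum_apply, Finset.smul_sum]
  exact Finset.sum_comm

end ModuleMatrices

section AmplifiedRow

open scoped Matrix.Norms.L2Operator

/-- The row matrix with blocks `c k r ⊗ 1`. -/
def ampRow {m n ρ : ℕ} (L : ℕ) (c : Fin n → Fin ρ → Matrix (Fin m) (Fin m) ℂ) :
    Matrix (Fin m × Fin L) (((Fin m × Fin ρ) × Fin L) × Fin n) ℂ :=
  Matrix.of fun P Q => if P.2 = Q.1.2 then c Q.2 Q.1.1.2 P.1 Q.1.1.1 else 0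

lemma ampRow_mul_conjTranspose {m n ρ : ℕ} (L : ℕ)
    (c : Fin n → Fin ρ → Matrix (Fin m) (Fin m) ℂ) :
    ampRow L c * (ampRow L c)ᴴ =
      kroneckerMap (· * ·) (∑ q : Fin n × Fin ρ, c q.1 q.2 * (c q.1 q.2)ᴴ)
        (1 : Matrix (Fin L) (Fin L) ℂ) := by
  ext ⟨i, l⟩ ⟨j, l'⟩
  simp only [ampRow, Matrix.mul_apply, of_apply, conjTranspose_apply, Fintype.sum_prod_type,
    kroneckerMap_apply, Matrix.sum_apply, Matrix.one_apply, apply_ite star, star_zero, ite_mul,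
    zero_mul, mul_ite, mul_zero, mul_one, Finset.sum_ite_irrel, Finset.sum_const_zero,
    Finset.sum_ite_eq, Finset.mem_univ, if_true]
  congr 1
  rw [Finset.sum_comm_cycle]
  exact Finset.sum_congr rfl fun k _ => Finset.sum_comm

lemma norm_ampRow_le_one {m n ρ : ℕ} (L : ℕ)
    (c : Fin n → Fin ρ → Matrix (Fin m) (Fin m) ℂ)
    (h : (∑ q : Fin n × Fin ρ, c q.1 q.2 * (c q.1 q.2)ᴴ) *
      (∑ q : Fin n × Fin ρ, c q.1 q.2 * (c q.1 q.2)ᴴ) =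
        ∑ q : Fin n × Fin ρ, c q.1 q.2 * (c q.1 q.2)ᴴ) :
    ‖ampRow L c‖ ≤ 1 := by
  refine l2_opNorm_le_one_of_mul_conjTranspose_idem _ ?_
  rw [ampRow_mul_conjTranspose, ← mul_kronecker_mul, h, Matrix.one_mul]

lemma ampRow_mul_blockDiagonal_mul {m n ρ σ L : ℕ}
    (c : Fin n → Fin ρ → Matrix (Fin m) (Fin m) ℂ)
    (d : Fin n → Fin σ → Matrix (Fin m) (Fin m) ℂ)
    (y : Fin n → Fin ρ → Fin σ → Matrix (Fin m) (Fin m) E)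
    (u : Fin n → (E →ₗ[ℂ] Matrix (Fin L) (Fin L) ℂ)) :
    (Matrix.of fun (P : Fin m × Fin L) (Q : Fin m × Fin L) =>
      ∑ k, u k ((∑ r, ∑ s, mulCME (c k r) (mulMEC (y k r s) (d k s))) P.1 Q.1) P.2 Q.2) =
    ampRow L c * (blockDiagonal fun k => Matrix.of
      fun (P : (Fin m × Fin ρ) × Fin L) (Q : (Fin m × Fin σ) × Fin L) =>
        u k (y k P.1.2 Q.1.2 P.1.1 Q.1.1) P.2 Q.2) *
      (ampRow L fun k s => (d k s)ᴴ)ᴴ := by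
  ext ⟨i, l⟩ ⟨j, l'⟩
  simp only [ampRow, Matrix.mul_apply, of_apply, conjTranspose_apply, Fintype.sum_prod_type,
    blockDiagonal_apply, Matrix.sum_apply, apply_ite star, star_zero, ite_mul, star_star,
    zero_mul, mul_ite, mul_zero, Finset.sum_ite_irrel, Finset.sum_const_zero,
    Finset.sum_ite_eq, Finset.sum_ite_eq', Finset.mem_univ, if_true,
    mulCME, mulMEC, map_sum, map_smul, Matrix.smul_apply, smul_eq_mul, Finset.mul_sum,
    Finset.sum_mul]
  rw [Finset.sum_comm_cycle (s := (Finset.univ : Finset (Fin m)))]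
  refine Finset.sum_congr rfl fun k _ => ?_
  rw [Finset.sum_comm, Finset.sum_comm (s := (Finset.univ : Finset (Fin m)))]
  refine Finset.sum_congr rfl fun t _ => ?_
  rw [Finset.sum_comm_cycle]
  refine Finset.sum_congr rfl fun j' _ => ?_
  rw [Finset.sum_comm]
  refine Finset.sum_congr rfl fun i' _ => Finset.sum_congr rfl fun r _ => ?_
  ring

/-- The `ℓ₁ⁿ(E)`-valued norm is controlled by any factorization through a row and a column
with projection Gram matrices. -/
lemma l1N_le_iSup (os : OpSpace E) {m n ρ σ : ℕ}
    (c : Fin n → Fin ρ → Matrix (Fin m) (Fin m) ℂ)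
    (d : Fin n → Fin σ → Matrix (Fin m) (Fin m) ℂ)
    (y : Fin n → Fin ρ → Fin σ → Matrix (Fin m) (Fin m) E)
    (hc : (∑ q : Fin n × Fin ρ, c q.1 q.2 * (c q.1 q.2)ᴴ) *
      (∑ q : Fin n × Fin ρ, c q.1 q.2 * (c q.1 q.2)ᴴ) =
        ∑ q : Fin n × Fin ρ, c q.1 q.2 * (c q.1 q.2)ᴴ)
    (hd : (∑ q : Fin n × Fin σ, (d q.1 q.2)ᴴ * (d q.1 q.2)ᴴᴴ) *
      (∑ q : Fin n × Fin σ, (d q.1 q.2)ᴴ * (d q.1 q.2)ᴴᴴ) =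
        ∑ q : Fin n × Fin σ, (d q.1 q.2)ᴴ * (d q.1 q.2)ᴴᴴ) :
    l1N os (Fin m) (Fin m) (Matrix.of fun i j k =>
        (∑ r, ∑ s, mulCME (c k r) (mulMEC (y k r s) (d k s))) i j) ≤
      ⨆ k, os.N (Fin m × Fin ρ) (Fin m × Fin σ)
        (Matrix.of fun P Q => y k P.2 Q.2 P.1 Q.1) := by
  have hS : 0 ≤ ⨆ k, os.N (Fin m × Fin ρ) (Fin m × Fin σ)
      (Matrix.of fun P Q => y k P.2 Q.2 P.1 Q.1) := Real.iSup_nonneg fun k => os.nonneg _ _ _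
  refine Real.sSup_le ?_ hS
  rintro t ⟨L, u, hu, rfl⟩
  rw [schNorm_top]
  simp only [of_apply]
  rw [ampRow_mul_blockDiagonal_mul c d y u]
  have hZ := l2_opNorm_blockDiagonal_le (fun k => Matrix.of
      fun (P : (Fin m × Fin ρ) × Fin L) (Q : (Fin m × Fin σ) × Fin L) =>
        u k (y k P.1.2 Q.1.2 P.1.1 Q.1.1) P.2 Q.2) hS fun k => by
    have h := hu k (Fin m × Fin ρ) (Fin m × Fin σ) (Matrix.of fun P Q => y k P.2 Q.2 P.1 Q.1)
    rw [schNorm_top] at h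
    exact h.trans (le_ciSup (f := fun k => os.N (Fin m × Fin ρ) (Fin m × Fin σ)
      (Matrix.of fun P Q => y k P.2 Q.2 P.1 Q.1)) (Set.finite_range _).bddAbove k)
  refine (l2_opNorm_mul _ _).trans ?_
  rw [l2_opNorm_conjTranspose]
  refine (mul_le_mul ((l2_opNorm_mul _ _).trans
    (mul_le_mul (norm_ampRow_le_one L c hc) hZ (norm_nonneg _) zero_le_one))
    (norm_ampRow_le_one L (fun k s => (d k s)ᴴ) hd) (norm_nonneg _) (by simpa using hS)).trans ?_
  simp

lemma l1N_nonneg (os : OpSpace E) {n : ℕ} (ι κ : Type) [Fintype ι] [DecidableEq ι]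
    [Fintype κ] [DecidableEq κ] (x : Matrix ι κ (Fin n → E)) : 0 ≤ l1N os ι κ x := by
  refine Real.sSup_nonneg ?_
  rintro t ⟨L, u, -, rfl⟩
  rw [schNorm_top]
  exact norm_nonneg _

end AmplifiedRow

/-- Lemma 2.2 of the paper: if `x_k = ∑_{r,s} a_k(r) y_k(r,s) b_k(s)` in `M_m ⊗ E`, then
`‖∑ δ_k ⊗ x_k‖_{L_p(τ_m; ℓ_1^n(E))}
   ≤ ‖∑ a_k(r) a_k(r)^*‖_p^{1/2} sup_k ‖(y_k(r,s))_{r,s}‖ ‖∑ b_k(s)^* b_k(s)‖_p^{1/2}`. -/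
theorem stmt_18 (os : OpSpace E) (p : ℝ) (hp : 1 ≤ p) (m n ρ σ : ℕ)
    (x : Fin n → Matrix (Fin m) (Fin m) E)
    (a : Fin n → Fin ρ → Matrix (Fin m) (Fin m) ℂ)
    (y : Fin n → Fin ρ → Fin σ → Matrix (Fin m) (Fin m) E)
    (b : Fin n → Fin σ → Matrix (Fin m) (Fin m) ℂ)
    (hdec : ∀ k, x k = ∑ r, ∑ s, mulCME (a k r) (mulMEC (y k r s) (b k s))) :
    LpL1 os p (Matrix.of fun i j => fun k => x k i j) ≤
      ntrNorm p (∑ k, ∑ r, a k r * (a k r)ᴴ) ^ (1/2 : ℝ) *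
        (⨆ k, os.N (Fin m × Fin ρ) (Fin m × Fin σ)
            (Matrix.of fun P Q => y k P.2 Q.2 P.1 Q.1)) *
        ntrNorm p (∑ k, ∑ s, (b k s)ᴴ * b k s) ^ (1/2 : ℝ) := by
  obtain ⟨α, c, hα, hac, hcc, hαn⟩ :=
    exists_sqrt_factorization p fun q : Fin n × Fin ρ => a q.1 q.2
  obtain ⟨β, d, hβ, hbd, hdd, hβn⟩ :=
    exists_sqrt_factorization p fun q : Fin n × Fin σ => (b q.1 q.2)ᴴ
  have hb (k : Fin n) (s : Fin σ) : b k s = (d (k, s))ᴴ * β := by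
    rw [← conjTranspose_conjTranspose (b k s), hbd (k, s), conjTranspose_mul, hβ]
  simp only [conjTranspose_conjTranspose, Fintype.sum_prod_type] at hαn hβn
  have hl1 := l1N_le_iSup os (fun k r => c (k, r)) (fun k s => (d (k, s))ᴴ) y hcc
    (by simpa only [conjTranspose_conjTranspose] using hdd)
  have hmem : LpL1 os p (Matrix.of fun i j => fun k => x k i j) ≤
      ntrNorm (2 * p) α * l1N os (Fin m) (Fin m) (Matrix.of fun i j k =>
        (∑ r, ∑ s, mulCME (c (k, r)) (mulMEC (y k r s) ((d (k, s))ᴴ))) i j) *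
        ntrNorm (2 * p) β := by
    refine csInf_le ⟨0, ?_⟩ ⟨α, β, _, ?_, rfl⟩
    · rintro t ⟨α', β', y', -, rfl⟩
      exact mul_nonneg (mul_nonneg (ntrNorm_nonneg _ _) (l1N_nonneg _ _ _ _)) (ntrNorm_nonneg _ _)
    · have hx (k : Fin n) : x k = mulCME α (mulMEC
          (∑ r, ∑ s, mulCME (c (k, r)) (mulMEC (y k r s) ((d (k, s))ᴴ))) β) := by
        rw [hdec k]
        simp only [mulMEC_sum, mulCME_sum]
        refine Finset.sum_congr rfl fun r _ => Finset.sum_congr rfl fun s _ => ?_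
        rw [hac (k, r), hb k s, mulCME_mul, mulMEC_mul, mulCME_mulMEC (c (k, r))]
      ext i j k
      rw [of_apply, hx k]
      simp [mulCME, mulMEC, Finset.sum_apply]
  rw [hαn, hβn] at hmem
  refine hmem.trans ?_
  exact mul_le_mul_of_nonneg_right (mul_le_mul_of_nonneg_left hl1
    (Real.rpow_nonneg (ntrNorm_nonneg _ _) _)) (Real.rpow_nonneg (ntrNorm_nonneg _ _) _)
end
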